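/- arXiv:2108.13997 — 2 statements merged into one kernel-verified Lean document; each statement's English description precedes it below -/
import Mathlib

section
/- The number of equivalence classes of monotone Boolean functions of 7 variables under the action of permutations of the input variables equals 490013148. -/
/-- Equivalence of monotone Boolean functions under permutation of input variables. -/
def mbfSetoid (n : ℕ) : Setoid {f : (Fin n → Bool) → Bool // Monotone f} where
  r f g := ∃ σ : Equiv.Perm (Fin n), ∀ x, f.1 x = g.1 (x ∘ σ)
  iseqv := by
    constructor
    · intro f; exact ⟨1, fun x => rfl⟩
    · rintro f g ⟨σ, h⟩
      refine ⟨σ⁻¹, fun x => ?_⟩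
      rw [h (x ∘ ⇑σ⁻¹)]
      have : (x ∘ ⇑σ⁻¹) ∘ ⇑σ = x := by funext i; simp
      rw [this]
    · rintro f g h ⟨σ, hfg⟩ ⟨τ, hgh⟩
      exact ⟨σ * τ, fun x => by rw [hfg x, hgh (x ∘ ⇑σ)]; rfl⟩

namespace MonotoneBool

open Finset

set_option maxRecDepth 100000

/-- The monotone Boolean functions of `n` variables that are invariant under `σ`. -/
def FM (n : ℕ) (σ : Equiv.Perm (Fin n)) : Type :=
  {f : (Fin n → Bool) → Bool // Monotone f ∧ ∀ x, f (x ∘ σ) = f x}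

noncomputable instance (n : ℕ) (σ : Equiv.Perm (Fin n)) : Fintype (FM n σ) :=
  @Fintype.ofFinite _ (Subtype.finite (p := fun f => Monotone f ∧ ∀ x, f (x ∘ σ) = f x))

section Burnside

variable {n : ℕ}

theorem monotone_comp_perm {f : (Fin n → Bool) → Bool} (hf : Monotone f) (σ : Equiv.Perm (Fin n)) :
    Monotone fun x : Fin n → Bool => f (x ∘ σ) :=
  fun _ _ h => hf fun i => h (σ i)

instance permAction : MulAction (Equiv.Perm (Fin n))
    {f : (Fin n → Bool) → Bool // Monotone f} where
  smul σ f := ⟨fun x => f.1 (x ∘ σ), monotone_comp_perm f.2 σ⟩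
  one_smul _ := rfl
  mul_smul _ _ _ := rfl

theorem smul_val (σ : Equiv.Perm (Fin n)) (f : {f : (Fin n → Bool) → Bool // Monotone f})
    (x : Fin n → Bool) : (σ • f).1 x = f.1 (x ∘ σ) := rfl

theorem mbfSetoid_eq_orbitRel :
    mbfSetoid n = MulAction.orbitRel (Equiv.Perm (Fin n))
      {f : (Fin n → Bool) → Bool // Monotone f} := by
  ext f g
  rw [MulAction.orbitRel_apply, MulAction.mem_orbit_iff]
  constructor
  · rintro ⟨σ, h⟩
    exact ⟨σ, Subtype.ext (funext fun x => (h x).symm)⟩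
  · rintro ⟨σ, rfl⟩
    exact ⟨σ, fun _ => rfl⟩

/-- The functions fixed by `σ` under the action are those of `FM n σ`. -/
def fixedByEquiv (σ : Equiv.Perm (Fin n)) :
    MulAction.fixedBy {f : (Fin n → Bool) → Bool // Monotone f} σ ≃ FM n σ where
  toFun f := ⟨f.1.1, f.1.2, fun x => congrFun (congrArg Subtype.val f.2) x⟩
  invFun f := ⟨⟨f.1, f.2.1⟩, Subtype.ext (funext f.2.2)⟩

theorem card_quotient_mul_factorial :
    Nat.card (Quotient (mbfSetoid n)) * n.factorial =
      ∑ σ : Equiv.Perm (Fin n), Fintype.card (FM n σ) := by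
  classical
  rw [mbfSetoid_eq_orbitRel]
  have := MulAction.sum_card_fixedBy_eq_card_orbits_mul_card_group (Equiv.Perm (Fin n))
    {f : (Fin n → Bool) → Bool // Monotone f}
  rw [Fintype.card_perm, Fintype.card_fin] at this
  rw [Nat.card_eq_fintype_card, ← this]
  exact sum_congr rfl fun σ _ => Fintype.card_congr (fixedByEquiv σ)

theorem card_FM_eq_of_cycleType_eq {σ τ : Equiv.Perm (Fin n)} (h : σ.cycleType = τ.cycleType) :
    Fintype.card (FM n σ) = Fintype.card (FM n τ) := by
  obtain ⟨c, hc⟩ := isConj_iff.1 (Equiv.Perm.isConj_iff_cycleType_eq.2 h)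
  have := MulAction.smul_fixedBy (α := {f : (Fin n → Bool) → Bool // Monotone f}) σ c
  rw [hc] at this
  have key : Nat.card (MulAction.fixedBy {f : (Fin n → Bool) → Bool // Monotone f} τ) =
      Nat.card (MulAction.fixedBy {f : (Fin n → Bool) → Bool // Monotone f} σ) := by
    rw [← this, Nat.card_coe_set_eq, Nat.card_coe_set_eq, Set.ncard_smul_set]
  rw [Nat.card_congr (fixedByEquiv τ), Nat.card_congr (fixedByEquiv σ)] at key
  simpa [Nat.card_eq_fintype_card] using key.symm

/-- If the permutations in `l` represent all conjugacy classes, the number of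
equivalence classes is a weighted sum over `l`. -/
theorem card_quotient_of_classes (l : List (Equiv.Perm (Fin n) × ℕ × ℕ))
    (hnd : (l.map fun p => p.1.cycleType).Nodup)
    (hsize : ∀ p ∈ l, #{σ : Equiv.Perm (Fin n) | σ.cycleType = p.1.cycleType} = p.2.1)
    (htot : (l.map fun p => p.2.1).sum = n.factorial)
    (hcard : ∀ p ∈ l, Fintype.card (FM n p.1) = p.2.2) :
    Nat.card (Quotient (mbfSetoid n)) * n.factorial = (l.map fun p => p.2.1 * p.2.2).sum := by
  classical
  set T : Finset (Multiset ℕ) := (l.map fun p => p.1.cycleType).toFinset with hT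
  have hsum : ∀ g : Multiset ℕ → ℕ, ∑ c ∈ T, g c = (l.map fun p => g p.1.cycleType).sum := by
    intro g
    rw [hT, List.sum_toFinset _ hnd, List.map_map]
    rfl
  have hall : ∀ σ ∈ (univ : Finset (Equiv.Perm (Fin n))), σ.cycleType ∈ T := by
    have h1 := card_eq_sum_card_fiberwise (f := fun σ : Equiv.Perm (Fin n) => σ.cycleType)
      (s := ({σ | σ.cycleType ∈ T} : Finset (Equiv.Perm (Fin n)))) (t := T)
      (fun σ hσ => by simpa using hσ)
    have h2 : ∑ c ∈ T, #{σ ∈ ({σ | σ.cycleType ∈ T} : Finset (Equiv.Perm (Fin n))) |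
        σ.cycleType = c} = n.factorial := by
      rw [← htot, ← List.map_congr_left hsize, ← hsum fun c => #{σ : Equiv.Perm (Fin n) |
        σ.cycleType = c}]
      refine sum_congr rfl fun c hc => ?_
      congr 1
      ext σ
      simp only [mem_filter, mem_univ, true_and]
      exact ⟨fun h => h.2, fun h => ⟨h ▸ hc, h⟩⟩
    rw [h2] at h1
    have h3 := (card_eq_iff_eq_univ _).1
      (h1.trans
        (by rw [Fintype.card_perm, Fintype.card_fin] : _ = Fintype.card (Equiv.Perm (Fin n))))
    intro σ hσ
    rw [← h3] at hσ
    exact (mem_filter.1 hσ).2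
  let N : Multiset ℕ → ℕ := fun c =>
    if h : ∃ σ : Equiv.Perm (Fin n), σ.cycleType = c then Fintype.card (FM n h.choose) else 0
  have hN : ∀ σ : Equiv.Perm (Fin n), Fintype.card (FM n σ) = N σ.cycleType := by
    intro σ
    have h : ∃ τ : Equiv.Perm (Fin n), τ.cycleType = σ.cycleType := ⟨σ, rfl⟩
    simp only [N, dif_pos h]
    exact (card_FM_eq_of_cycleType_eq h.choose_spec).symm
  rw [card_quotient_mul_factorial, ← sum_fiberwise_of_maps_to hall]
  have h4 : ∀ c ∈ T, (∑ σ : Equiv.Perm (Fin n) with σ.cycleType = c, Fintype.card (FM n σ)) =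
      #{σ : Equiv.Perm (Fin n) | σ.cycleType = c} * N c := by
    intro c _
    rw [card_eq_sum_ones, sum_mul]
    refine sum_congr rfl fun σ hσ => ?_
    rw [hN, (mem_filter.1 hσ).2, one_mul]
  rw [sum_congr rfl h4, hsum]
  refine congrArg List.sum (List.map_congr_left fun p hp => ?_)
  rw [hsize p hp, ← hN, hcard p hp]

end Burnside

instance (n : ℕ) (σ : Equiv.Perm (Fin n)) : PartialOrder (FM n σ) :=
  inferInstanceAs (PartialOrder {f : (Fin n → Bool) → Bool // Monotone f ∧ ∀ x, f (x ∘ σ) = f x})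

theorem FM.le_iff {n : ℕ} {σ : Equiv.Perm (Fin n)} {f g : FM n σ} : f ≤ g ↔ ∀ x, f.1 x ≤ g.1 x :=
  Iff.rfl

/-- Pairs `x ≤ y` of elements of `P`, ordered componentwise. -/
abbrev OrderedPair (P : Type) [PartialOrder P] : Type := {p : P × P // p.1 ≤ p.2}

section Split

variable {n : ℕ}

theorem cons_le_cons_iff {a b : Bool} {x y : Fin n → Bool} :
    (Fin.cons a x : Fin (n + 1) → Bool) ≤ Fin.cons b y ↔ a ≤ b ∧ x ≤ y :=
  ⟨fun h => ⟨h 0, fun i => h i.succ⟩, fun h i => Fin.cases h.1 h.2 i⟩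

theorem cons_comp_of_fix {σ : Equiv.Perm (Fin (n + 1))} {τ : Equiv.Perm (Fin n)} (h0 : σ 0 = 0)
    (hs : ∀ i : Fin n, σ i.succ = (τ i).succ) (a : Bool) (x : Fin n → Bool) :
    (Fin.cons a x : Fin (n + 1) → Bool) ∘ σ = Fin.cons a (x ∘ τ) := by
  funext i
  refine Fin.cases ?_ (fun i => ?_) i
  · simp [h0]
  · simp [hs]

/-- Splitting along a fixed variable. -/
def splitFixed {σ : Equiv.Perm (Fin (n + 1))} {τ : Equiv.Perm (Fin n)} (h0 : σ 0 = 0)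
    (hs : ∀ i : Fin n, σ i.succ = (τ i).succ) : FM (n + 1) σ ≃o OrderedPair (FM n τ) where
  toFun f :=
    ⟨(⟨fun x => f.1 (Fin.cons false x), fun _ _ h => f.2.1 (cons_le_cons_iff.2 ⟨le_rfl, h⟩),
        fun x => by simpa only [cons_comp_of_fix h0 hs] using f.2.2 (Fin.cons false x)⟩,
      ⟨fun x => f.1 (Fin.cons true x), fun _ _ h => f.2.1 (cons_le_cons_iff.2 ⟨le_rfl, h⟩),
        fun x => by simpa only [cons_comp_of_fix h0 hs] using f.2.2 (Fin.cons true x)⟩),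
      fun _ => f.2.1 (cons_le_cons_iff.2 ⟨Bool.false_le _, le_rfl⟩)⟩
  invFun p :=
    ⟨fun x => bif x 0 then p.1.2.1 (Fin.tail x) else p.1.1.1 (Fin.tail x), by
      intro x y h
      have ht : Fin.tail x ≤ Fin.tail y := fun i => h i.succ
      have h00 : x 0 ≤ y 0 := h 0
      dsimp only
      rcases hx : x 0 <;> rcases hy : y 0
      · exact p.1.1.2.1 ht
      · exact (p.2 _).trans (p.1.2.2.1 ht)
      · rw [hx, hy] at h00
        exact absurd h00 (by decide)
      · exact p.1.2.2.1 ht, by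
      intro x
      have : Fin.tail (x ∘ σ) = Fin.tail x ∘ τ := by
        funext i
        simp [Fin.tail, hs]
      simp only [this, Function.comp_apply, h0, p.1.1.2.2, p.1.2.2.2]⟩
  left_inv f := by
    apply Subtype.ext
    funext x
    dsimp only
    rcases hx : x 0 <;> simp only [cond_true, cond_false] <;> rw [← hx, Fin.cons_self_tail]
  right_inv p := rfl
  map_rel_iff' {f g} := by
    constructor
    · intro h x
      rw [← Fin.cons_self_tail x]
      rcases x 0
      · exact h.1 _
      · exact h.2 _
    · intro h
      exact ⟨fun x => h _, fun x => h _⟩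

/-- Ordered pairs in isomorphic orders. -/
def orderedPairCongr {P Q : Type} [PartialOrder P] [PartialOrder Q] (e : P ≃o Q) :
    OrderedPair P ≃o OrderedPair Q where
  toEquiv := (e.toEquiv.prodCongr e.toEquiv).subtypeEquiv fun _ => (e.le_iff_le).symm
  map_rel_iff' := and_congr e.le_iff_le e.le_iff_le

theorem cons_cons_comp_of_swap {σ : Equiv.Perm (Fin (n + 2))} {τ : Equiv.Perm (Fin n)}
    (h0 : σ 0 = 1) (h1 : σ 1 = 0) (hs : ∀ i : Fin n, σ i.succ.succ = (τ i).succ.succ)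
    (a b : Bool) (x : Fin n → Bool) :
    (Fin.cons a (Fin.cons b x : Fin (n + 1) → Bool) : Fin (n + 2) → Bool) ∘ σ =
      Fin.cons b (Fin.cons a (x ∘ τ) : Fin (n + 1) → Bool) := by
  funext i
  refine Fin.cases ?_ (fun i => Fin.cases ?_ (fun i => ?_) i) i
  · simp only [Function.comp_apply, h0]
    rfl
  · simp only [Function.comp_apply, Fin.succ_zero_eq_one, h1]
    rfl
  · simp only [Function.comp_apply, hs]
    rfl

/-- Splitting along a pair of exchanged variables. -/
def splitSwap {σ : Equiv.Perm (Fin (n + 2))} {τ : Equiv.Perm (Fin n)}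
    (h0 : σ 0 = 1) (h1 : σ 1 = 0) (hs : ∀ i : Fin n, σ i.succ.succ = (τ i).succ.succ) :
    FM (n + 2) σ ≃
      Σ w : FM n (τ * τ), {u : FM n τ // ∀ x, u.1 x ≤ w.1 x} × {v : FM n τ // ∀ x, w.1 x ≤ v.1 x}
    where
  toFun f :=
    have inv : ∀ a b x, f.1 (Fin.cons b (Fin.cons a (x ∘ τ) : Fin (n + 1) → Bool)) =
        f.1 (Fin.cons a (Fin.cons b x : Fin (n + 1) → Bool)) := fun a b x => by
      rw [← cons_cons_comp_of_swap h0 h1 hs, f.2.2]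
    have mon : ∀ {a b c d x y}, a ≤ c → b ≤ d → x ≤ y →
        f.1 (Fin.cons a (Fin.cons b x : Fin (n + 1) → Bool)) ≤
        f.1 (Fin.cons c (Fin.cons d y : Fin (n + 1) → Bool)) := fun h h' h'' =>
      f.2.1 (cons_le_cons_iff.2 ⟨h, cons_le_cons_iff.2 ⟨h', h''⟩⟩)
    ⟨⟨fun x => f.1 (Fin.cons true (Fin.cons false x : Fin (n + 1) → Bool)),
      fun _ _ h => mon le_rfl le_rfl h,
      fun x => (inv false true (x ∘ τ)).trans (inv true false x)⟩,
     ⟨⟨fun x => f.1 (Fin.cons false (Fin.cons false x : Fin (n + 1) → Bool)),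
      fun _ _ h => mon le_rfl le_rfl h, inv false false⟩,
      fun _ => mon (Bool.false_le _) le_rfl le_rfl⟩,
     ⟨⟨fun x => f.1 (Fin.cons true (Fin.cons true x : Fin (n + 1) → Bool)),
      fun _ _ h => mon le_rfl le_rfl h, inv true true⟩,
      fun _ => mon le_rfl (Bool.false_le _) le_rfl⟩⟩
  invFun p :=
    ⟨fun x => bif x 0 then
        bif x 1 then p.2.2.1.1 (fun i => x i.succ.succ) else p.1.1 (fun i => x i.succ.succ)
      else
        bif x 1 then p.1.1 ((fun i => x i.succ.succ) ∘ τ)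
        else p.2.1.1.1 (fun i => x i.succ.succ), by
      obtain ⟨w, ⟨u, hu⟩, v, hv⟩ := p
      intro x y h
      have ht : (fun i : Fin n => x i.succ.succ) ≤ fun i => y i.succ.succ := fun i => h i.succ.succ
      have ht' : (fun i : Fin n => x i.succ.succ) ∘ τ ≤ (fun i => y i.succ.succ) ∘ τ :=
        fun i => ht (τ i)
      have e0 : x 0 ≤ y 0 := h 0
      have e1 : x 1 ≤ y 1 := h 1
      dsimp only
      have hu' : ∀ z, u.1 z ≤ w.1 (z ∘ τ) := fun z => (u.2.2 z).symm.le.trans (hu _)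
      have hv' : ∀ z, w.1 (z ∘ τ) ≤ v.1 z := fun z => (hv _).trans (v.2.2 z).le
      rcases hx : x 0 <;> rcases hy : y 0 <;> rcases hx' : x 1 <;> rcases hy' : y 1 <;>
        rw [hx, hy] at e0 <;> rw [hx', hy'] at e1 <;> simp only [cond_true, cond_false] <;>
        first
        | exact absurd e0 (by decide)
        | exact absurd e1 (by decide)
        | skip
      · exact u.2.1 ht
      · exact (u.2.1 ht).trans (hu' _)
      · exact w.2.1 ht'
      · exact (u.2.1 ht).trans (hu _)
      · exact (u.2.1 ht).trans ((hu _).trans (hv _))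
      · exact (w.2.1 ht').trans (hv' _)
      · exact w.2.1 ht
      · exact (w.2.1 ht).trans (hv _)
      · exact v.2.1 ht, by
      obtain ⟨w, ⟨u, hu⟩, v, hv⟩ := p
      intro x
      have hx : (fun i : Fin n => x (σ i.succ.succ)) = (fun i => x i.succ.succ) ∘ τ := by
        funext i
        simp [hs]
      simp only [Function.comp_apply, h0, h1, hx]
      have hw := w.2.2 fun i => x i.succ.succ
      rcases x 0 <;> rcases x 1 <;> simp only [cond_true, cond_false]
      · exact u.2.2 _
      · exact hw
      · exact v.2.2 _⟩
  left_inv f := by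
    apply Subtype.ext
    funext x
    have hx : x = Fin.cons (x 0) (Fin.cons (x 1) fun i => x i.succ.succ : Fin (n + 1) → Bool) := by
      funext i
      exact Fin.cases rfl (fun i => Fin.cases rfl (fun _ => rfl) i) i
    have inv := f.2.2 (Fin.cons false (Fin.cons true fun i => x i.succ.succ : Fin (n + 1) → Bool))
    rw [cons_cons_comp_of_swap h0 h1 hs] at inv
    conv_rhs => rw [hx]
    dsimp only
    rcases x 0 <;> rcases x 1 <;> simp only [cond_true, cond_false]
    exact inv
  right_inv p := rfl

end Split

section Counting

open Classical in
/-- The number of monotone maps from the three-dimensional cube to `P`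
with prescribed largest value `t`. -/
noncomputable def cubeCount {P : Type} [Fintype P] [PartialOrder P] (t : P) : ℕ :=
  ∑ a : P, if a ≤ t then (∑ b : P, if b ≤ t ∧ a ≤ b then
    (∑ c : P, if c ≤ t ∧ a ≤ c then
      (∑ x : P, if x ≤ t ∧ a ≤ x ∧ x ≤ b then
        (∑ y : P, if y ≤ t ∧ x ≤ y ∧ c ≤ y then 1 else 0) else 0) ^ 2 else 0) else 0) else 0

variable {P : Type} [Fintype P] [PartialOrder P]

theorem card_orderedPair_orderedPair [Fintype (OrderedPair (OrderedPair P))] :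
    Fintype.card (OrderedPair (OrderedPair P)) =
      ∑ v : P, ∑ u : P, Nat.card {w : P // u ≤ w ∧ w ≤ v} ^ 2 := by
  classical
  have e : OrderedPair (OrderedPair P) ≃
      Σ v : P, Σ u : P, {w : P // u ≤ w ∧ w ≤ v} × {w : P // u ≤ w ∧ w ≤ v} :=
    { toFun := fun p => ⟨p.1.2.1.2, p.1.1.1.1, ⟨p.1.1.1.2, p.1.1.2, p.2.2⟩,
        ⟨p.1.2.1.1, p.2.1, p.1.2.2⟩⟩
      invFun := fun q => ⟨(⟨(q.2.1, q.2.2.1.1), q.2.2.1.2.1⟩, ⟨(q.2.2.2.1, q.1), q.2.2.2.2.2⟩),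
        q.2.2.2.2.1, q.2.2.1.2.2⟩
      left_inv := fun _ => rfl
      right_inv := fun _ => rfl }
  rw [Fintype.card_congr e, Fintype.card_sigma]
  refine sum_congr rfl fun v _ => ?_
  rw [Fintype.card_sigma]
  refine sum_congr rfl fun u _ => ?_
  rw [Fintype.card_prod, sq, Nat.card_eq_fintype_card]

open Classical in
theorem sum_orderedPair (F : P → P → ℕ) :
    ∑ p : OrderedPair P, F p.1.1 p.1.2 = ∑ y : P, ∑ x : P, if x ≤ y then F x y else 0 := by
  rw [sum_comm, ← Fintype.sum_prod_type' (f := fun x y => if x ≤ y then F x y else 0),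
    ← sum_filter]
  exact (sum_subtype _ (fun p => by simp) fun p : P × P => F p.1 p.2).symm

theorem card_cube [Fintype (OrderedPair (OrderedPair (OrderedPair P)))] :
    Fintype.card (OrderedPair (OrderedPair (OrderedPair P))) = ∑ t : P, cubeCount t := by
  classical
  have hc : ∀ u v : OrderedPair P, Nat.card {w : OrderedPair P // u ≤ w ∧ w ≤ v} =
      ∑ y : P, ∑ x : P, if x ≤ y then
        (if (u.1.1 ≤ x ∧ u.1.2 ≤ y) ∧ x ≤ v.1.1 ∧ y ≤ v.1.2 then 1 else 0) else 0 := by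
    intro u v
    rw [← sum_orderedPair fun x y => if (u.1.1 ≤ x ∧ u.1.2 ≤ y) ∧ x ≤ v.1.1 ∧ y ≤ v.1.2
      then 1 else 0, ← card_filter, Nat.card_eq_fintype_card, Fintype.card_subtype]
    rfl
  rw [card_orderedPair_orderedPair]
  simp only [hc]
  rw [sum_orderedPair fun b t => ∑ u : OrderedPair P, (∑ y : P, ∑ x : P, if x ≤ y then
        (if (u.1.1 ≤ x ∧ u.1.2 ≤ y) ∧ x ≤ b ∧ y ≤ t then 1 else 0) else 0) ^ 2]
  refine sum_congr rfl fun t _ => ?_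
  have hu : ∀ b : P, (∑ u : OrderedPair P, (∑ y : P, ∑ x : P, if x ≤ y then
        (if (u.1.1 ≤ x ∧ u.1.2 ≤ y) ∧ x ≤ b ∧ y ≤ t then 1 else 0) else 0) ^ 2) =
      ∑ a : P, ∑ c : P, if a ≤ c then (∑ y : P, ∑ x : P, if x ≤ y then
        (if (a ≤ x ∧ c ≤ y) ∧ x ≤ b ∧ y ≤ t then 1 else 0) else 0) ^ 2 else 0 := by
    intro b
    rw [sum_orderedPair fun a c => (∑ y : P, ∑ x : P, if x ≤ y then
        (if (a ≤ x ∧ c ≤ y) ∧ x ≤ b ∧ y ≤ t then 1 else 0) else 0) ^ 2, sum_comm]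
  have hin : ∀ a b c : P, b ≤ t → (∑ y : P, ∑ x : P, if x ≤ y then
        (if (a ≤ x ∧ c ≤ y) ∧ x ≤ b ∧ y ≤ t then 1 else 0) else 0) =
      ∑ x : P, if x ≤ t ∧ a ≤ x ∧ x ≤ b then
        (∑ y : P, if y ≤ t ∧ x ≤ y ∧ c ≤ y then 1 else 0) else 0 := by
    intro a b c hb
    rw [sum_comm]
    refine sum_congr rfl fun x _ => ?_
    by_cases hx : a ≤ x ∧ x ≤ b
    · rw [if_pos ⟨hx.2.trans hb, hx⟩]
      refine sum_congr rfl fun y _ => ?_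
      rw [← ite_and]
      exact if_congr (by tauto) rfl rfl
    · rw [if_neg fun h => hx h.2]
      refine sum_eq_zero fun y _ => ?_
      rw [← ite_and]
      exact if_neg (by tauto)
  simp only [hu]
  rw [cubeCount]
  have hswap : (∑ b : P, if b ≤ t then ∑ a : P, ∑ c : P, if a ≤ c then (∑ y : P, ∑ x : P,
      if x ≤ y then (if (a ≤ x ∧ c ≤ y) ∧ x ≤ b ∧ y ≤ t then 1 else 0) else 0) ^ 2 else 0 else 0) =
      ∑ a : P, ∑ b : P, if b ≤ t then ∑ c : P, if a ≤ c then (∑ y : P, ∑ x : P,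
      if x ≤ y then (if (a ≤ x ∧ c ≤ y) ∧ x ≤ b ∧ y ≤ t then 1 else 0) else 0) ^ 2 else 0
      else 0 := by
    rw [sum_comm]
    refine sum_congr rfl fun b _ => ?_
    split_ifs
    · rfl
    · simp
  rw [hswap]
  refine sum_congr rfl fun a _ => ?_
  have hb : ∀ b : P, (if b ≤ t then ∑ c : P, if a ≤ c then (∑ y : P, ∑ x : P,
      if x ≤ y then (if (a ≤ x ∧ c ≤ y) ∧ x ≤ b ∧ y ≤ t then 1 else 0) else 0) ^ 2 else 0 else 0) =
      if b ≤ t ∧ a ≤ b then (∑ c : P, if c ≤ t ∧ a ≤ c then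
      (∑ x : P, if x ≤ t ∧ a ≤ x ∧ x ≤ b then
        (∑ y : P, if y ≤ t ∧ x ≤ y ∧ c ≤ y then 1 else 0) else 0) ^ 2 else 0) else 0 := by
    intro b
    by_cases hb : b ≤ t
    · rw [if_pos hb]
      simp only [hin a b _ hb]
      by_cases hab : a ≤ b
      · rw [if_pos ⟨hb, hab⟩]
        refine sum_congr rfl fun c _ => ?_
        by_cases hct : c ≤ t
        · exact if_congr (by tauto) rfl rfl
        · rw [if_neg (c := c ≤ t ∧ a ≤ c) fun h => hct h.1]
          by_cases hac : a ≤ c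
          · rw [if_pos hac]
            refine (pow_eq_zero_iff two_ne_zero).2 (sum_eq_zero fun x _ => ?_)
            by_cases hx : x ≤ t ∧ a ≤ x ∧ x ≤ b
            · rw [if_pos hx]
              exact sum_eq_zero fun y _ => if_neg fun h => hct (h.2.2.trans h.1)
            · rw [if_neg hx]
          · rw [if_neg hac]
      · rw [if_neg (c := b ≤ t ∧ a ≤ b) fun h => hab h.2]
        refine sum_eq_zero fun c _ => ?_
        by_cases hac : a ≤ c
        · rw [if_pos hac]
          refine (pow_eq_zero_iff two_ne_zero).2 (sum_eq_zero fun x _ => ?_)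
          exact if_neg fun h => hab (h.2.1.trans h.2.2)
        · rw [if_neg hac]
    · rw [if_neg hb, if_neg fun h => hb h.1]
  rw [sum_congr rfl fun b _ => hb b]
  by_cases hat : a ≤ t
  · rw [if_pos hat]
  · rw [if_neg hat]
    exact sum_eq_zero fun b _ => if_neg fun h => hat (h.2.trans h.1)

theorem cubeCount_apply_orderIso (e : P ≃o P) (t : P) : cubeCount (e t) = cubeCount t := by
  classical
  unfold cubeCount
  rw [← Equiv.sum_comp e.toEquiv]
  refine sum_congr rfl fun a _ => if_congr e.le_iff_le ?_ rfl
  rw [← Equiv.sum_comp e.toEquiv]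
  refine sum_congr rfl fun b _ => if_congr (and_congr e.le_iff_le e.le_iff_le) ?_ rfl
  rw [← Equiv.sum_comp e.toEquiv]
  refine sum_congr rfl fun c _ => if_congr (and_congr e.le_iff_le e.le_iff_le)
    (congrArg (· ^ 2) ?_) rfl
  rw [← Equiv.sum_comp e.toEquiv]
  refine sum_congr rfl fun x _ => if_congr
    (and_congr e.le_iff_le (and_congr e.le_iff_le e.le_iff_le)) ?_ rfl
  rw [← Equiv.sum_comp e.toEquiv]
  exact sum_congr rfl fun y _ => if_congr
    (and_congr e.le_iff_le (and_congr e.le_iff_le e.le_iff_le)) rfl rfl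

end Counting

section Mask

variable {n : ℕ}

/-- The point of the cube whose coordinates are the binary digits of `k`. -/
def point (n k : ℕ) : Fin n → Bool := fun i => k.testBit i

/-- The truth table of `f`, as a bit mask. -/
def toMask (f : (Fin n → Bool) → Bool) : ℕ := Nat.ofBits fun k : Fin (2 ^ n) => f (point n k)

theorem point_ofBits (x : Fin n → Bool) : point n (Nat.ofBits x) = x := by
  funext i
  simp [point]

theorem exists_point_eq (x : Fin n → Bool) : ∃ k < 2 ^ n, point n k = x :=
  ⟨Nat.ofBits x, Nat.ofBits_lt_two_pow x, point_ofBits x⟩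

theorem ofBits_point {k : ℕ} (hk : k < 2 ^ n) : Nat.ofBits (point n k) = k := by
  refine Nat.eq_of_testBit_eq fun i => ?_
  rw [Nat.testBit_ofBits]
  split_ifs with h
  · rfl
  · exact (Nat.testBit_lt_two_pow (hk.trans_le (Nat.pow_le_pow_right two_pos (not_lt.1 h)))).symm

theorem testBit_toMask (f : (Fin n → Bool) → Bool) {k : ℕ} (hk : k < 2 ^ n) :
    (toMask f).testBit k = f (point n k) := by
  rw [toMask, Nat.testBit_ofBits_lt _ _ hk]

theorem testBit_toMask_of_le (f : (Fin n → Bool) → Bool) {k : ℕ} (hk : 2 ^ n ≤ k) :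
    (toMask f).testBit k = false := by
  rw [toMask, Nat.testBit_ofBits, dif_neg hk.not_gt]

theorem toMask_injective : Function.Injective (toMask : ((Fin n → Bool) → Bool) → ℕ) := by
  intro f g h
  funext x
  obtain ⟨k, hk, rfl⟩ := exists_point_eq x
  rw [← testBit_toMask f hk, h, testBit_toMask g hk]

theorem beq_iff {a b : ℕ} : Nat.beq a b = true ↔ a = b := by
  rw [Nat.beq_eq]

/-- Equality of natural numbers, in a form which the kernel decides quickly. -/
def Evaluates (a b : ℕ) : Prop := Nat.beq a b = true

instance (a b : ℕ) : Decidable (Evaluates a b) := inferInstanceAs (Decidable (_ = true))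

theorem Evaluates.eq {a b : ℕ} (h : Evaluates a b) : a = b := beq_iff.1 h

/-- Inclusion of bit masks. -/
def leM (a b : ℕ) : Bool := Nat.beq (Nat.land a b) a

theorem leM_iff {a b : ℕ} : leM a b = true ↔ ∀ k, a.testBit k = true → b.testBit k = true := by
  rw [leM, Nat.beq_eq]
  constructor
  · intro h k hk
    have := congrArg (Nat.testBit · k) h
    rw [← h] at hk
    exact (Bool.and_eq_true_iff.1 ((Nat.testBit_and a b k).symm.trans hk)).2
  · intro h
    refine Nat.eq_of_testBit_eq fun k => (Nat.testBit_and a b k).trans ?_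
    have := h k
    cases ha : a.testBit k <;> simp_all

theorem leM_toMask_iff {f g : (Fin n → Bool) → Bool} :
    leM (toMask f) (toMask g) = true ↔ ∀ x, f x ≤ g x := by
  rw [leM_iff]
  constructor
  · intro h x
    obtain ⟨k, hk, rfl⟩ := exists_point_eq x
    have := h k
    rw [testBit_toMask f hk, testBit_toMask g hk] at this
    exact Bool.le_iff_imp.2 this
  · intro h k hf
    rcases lt_or_ge k (2 ^ n) with hk | hk
    · rw [testBit_toMask _ hk] at hf ⊢
      exact Bool.le_iff_imp.1 (h _) hf
    · rw [testBit_toMask_of_le _ hk] at hf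
      exact absurd hf Bool.false_ne_true

theorem point_le_iff {j k : ℕ} (hj : j < 2 ^ n) :
    point n j ≤ point n k ↔ leM j k = true := by
  rw [leM_iff]
  constructor
  · intro h i hi
    rcases lt_or_ge i n with hin | hin
    · exact Bool.le_iff_imp.1 (h ⟨i, hin⟩) hi
    · rw [Nat.testBit_lt_two_pow (hj.trans_le (Nat.pow_le_pow_right two_pos hin))] at hi
      exact absurd hi Bool.false_ne_true
  · intro h i
    exact Bool.le_iff_imp.2 (h i)

end Mask

section Enumeration

/-- Concatenation, in a form which the kernel evaluates quickly. -/
noncomputable def append (l m : List ℕ) : List ℕ := List.rec m (fun a _ ih => a :: ih) l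

/-- The masks obtained from `m` by deciding, for each pair `(O, C)` of `s` in turn, whether to add
`O`; not adding `O` is possible only if none of the elements of `C` are present. -/
noncomputable def leaves (s : List (ℕ × ℕ)) : ℕ → List ℕ :=
  List.rec (fun m => [m]) (fun a _ ih m => append (ih (Nat.lor m a.1))
    (Bool.rec [] (ih m) (Nat.beq (Nat.land m a.2) 0))) s

/-- The sum of the values of `g` over `leaves s m`. -/
noncomputable def sumLeaves (g : ℕ → ℕ) (s : List (ℕ × ℕ)) : ℕ → ℕ :=
  List.rec (fun m => g m) (fun a _ ih m => Nat.add (ih (Nat.lor m a.1))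
    (Bool.rec 0 (ih m) (Nat.beq (Nat.land m a.2) 0))) s

theorem append_eq (l m : List ℕ) : append l m = l ++ m := by
  induction l with
  | nil => rfl
  | cons a l ih => exact congrArg (a :: ·) ih

theorem leaves_cons (a : ℕ × ℕ) (s : List (ℕ × ℕ)) (m : ℕ) :
    leaves (a :: s) m = leaves s (m ||| a.1) ++ if m &&& a.2 = 0 then leaves s m else [] := by
  refine (append_eq _ _).trans (congrArg (leaves s (m ||| a.1) ++ ·) ?_)
  change @Bool.rec (fun _ => List ℕ) [] (leaves s m) (Nat.beq (m &&& a.2) 0) = _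
  split_ifs with h
  · rw [beq_iff.2 h]
  · rw [Bool.eq_false_iff.2 fun h' => h (beq_iff.1 h')]

theorem sumLeaves_eq (g : ℕ → ℕ) (s : List (ℕ × ℕ)) (m : ℕ) :
    sumLeaves g s m = ((leaves s m).map g).sum := by
  induction s generalizing m with
  | nil => exact (List.sum_singleton).symm
  | cons a s ih =>
    rw [leaves_cons, List.map_append, List.sum_append, ← ih]
    refine congrArg (sumLeaves g s (m ||| a.1) + ·) ?_
    change @Bool.rec (fun _ => ℕ) 0 (sumLeaves g s m) (Nat.beq (m &&& a.2) 0) = _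
    split_ifs with h
    · rw [beq_iff.2 h, ← ih]
    · rw [Bool.eq_false_iff.2 fun h' => h (beq_iff.1 h')]
      rfl

theorem land_eq_zero_iff {a b : ℕ} :
    a &&& b = 0 ↔ ∀ k, a.testBit k = true → b.testBit k = false := by
  constructor
  · intro h k hk
    have := congrArg (Nat.testBit · k) h
    simpa [Nat.testBit_and, hk] using this
  · intro h
    refine Nat.eq_of_testBit_eq fun k => ?_
    rw [Nat.testBit_and, Nat.zero_testBit]
    have := h k
    cases ha : a.testBit k <;> simp_all

/-- The order conditions under which `leaves` enumerates each mask once. -/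
def Ordered (s : List (ℕ × ℕ)) : Prop :=
  (∀ p ∈ s, p.1 ≠ 0) ∧ s.Pairwise fun p q => q.1 &&& p.1 = 0 ∧ q.1 &&& p.2 = 0

instance (s : List (ℕ × ℕ)) : Decidable (Ordered s) := inferInstanceAs (Decidable (_ ∧ _))

/-- The two admissible choices for the pair `p`. -/
def Decided (m' : ℕ) (p : ℕ × ℕ) : Prop :=
  (∀ k, p.1.testBit k = true → m'.testBit k = true) ∨
    ∀ k, p.1.testBit k = true ∨ p.2.testBit k = true → m'.testBit k = false

theorem mem_leaves {s : List (ℕ × ℕ)} (hs : Ordered s) {m m' : ℕ} (hm : ∀ p ∈ s, p.1 &&& m = 0) :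
    m' ∈ leaves s m ↔
      (∀ k, (∀ p ∈ s, p.1.testBit k = false) → m'.testBit k = m.testBit k) ∧
        ∀ p ∈ s, Decided m' p := by
  induction s generalizing m with
  | nil =>
    change m' ∈ [m] ↔ _
    simp only [List.mem_singleton, List.not_mem_nil, false_implies, implies_true, and_true,
      forall_const]
    exact ⟨fun h k => h ▸ rfl, Nat.eq_of_testBit_eq⟩
  | cons a s ih =>
    obtain ⟨hne, hpw⟩ := hs
    rw [List.pairwise_cons] at hpw
    have hs' : Ordered s := ⟨fun p hp => hne p (List.mem_cons_of_mem _ hp), hpw.2⟩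
    have ham := land_eq_zero_iff.1 (hm a List.mem_cons_self)
    have hm1 : ∀ p ∈ s, p.1 &&& m = 0 := fun p hp => hm p (List.mem_cons_of_mem _ hp)
    have hm2 : ∀ p ∈ s, p.1 &&& (m ||| a.1) = 0 := by
      intro p hp
      refine land_eq_zero_iff.2 fun k hk => ?_
      rw [Nat.testBit_or, land_eq_zero_iff.1 (hm1 p hp) k hk,
        land_eq_zero_iff.1 (hpw.1 p hp).1 k hk]
      rfl
    have ha_s : ∀ k, a.1.testBit k = true → ∀ p ∈ s, p.1.testBit k = false := by
      intro k hk p hp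
      by_contra h
      rw [land_eq_zero_iff.1 (hpw.1 p hp).1 k (by simpa using h)] at hk
      exact Bool.false_ne_true hk
    have hc_s : ∀ k, a.2.testBit k = true → ∀ p ∈ s, p.1.testBit k = false := by
      intro k hk p hp
      by_contra h
      rw [land_eq_zero_iff.1 (hpw.1 p hp).2 k (by simpa using h)] at hk
      exact Bool.false_ne_true hk
    rw [leaves_cons, List.mem_append, ih hs' hm2]
    simp only [List.forall_mem_cons]
    constructor
    · rintro (⟨h1, h2⟩ | h)
      · refine ⟨fun k hk => ?_, Or.inl fun k hk => ?_, h2⟩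
        · rw [h1 k hk.2, Nat.testBit_or, hk.1, Bool.or_false]
        · rw [h1 k (ha_s k hk), Nat.testBit_or, hk, Bool.or_true]
      · split_ifs at h with hc
        · obtain ⟨h1, h2⟩ := (ih hs' hm1).1 h
          refine ⟨fun k hk => h1 k hk.2, Or.inr fun k hk => ?_, h2⟩
          rcases hk with hk | hk
          · rw [h1 k (ha_s k hk)]
            exact ham k hk
          · rw [h1 k (hc_s k hk)]
            by_contra h'
            rw [land_eq_zero_iff.1 hc k (by simpa using h')] at hk
            exact Bool.false_ne_true hk
        · exact absurd h List.not_mem_nil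
    · rintro ⟨h1, ha, h2⟩
      have hrest : ∀ k, a.1.testBit k = false → (∀ p ∈ s, p.1.testBit k = false) →
          m'.testBit k = m.testBit k := fun k h h' => h1 k ⟨h, h'⟩
      rcases ha with ha | ha
      · refine Or.inl ⟨fun k hk => ?_, h2⟩
        rw [Nat.testBit_or]
        cases hak : a.1.testBit k
        · rw [hrest k hak hk, Bool.or_false]
        · rw [ha k hak, Bool.or_true]
      · right
        have hc : m &&& a.2 = 0 := by
          refine land_eq_zero_iff.2 fun k hk => ?_
          by_contra hck
          rw [Bool.not_eq_false] at hck
          have h3 := ha k (Or.inr hck)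
          cases hak : a.1.testBit k
          · rw [hrest k hak (hc_s k hck), hk] at h3
            exact Bool.false_ne_true h3.symm
          · rw [ham k hak] at hk
            exact Bool.false_ne_true hk
        rw [if_pos hc, ih hs' hm1]
        refine ⟨fun k hk => ?_, h2⟩
        cases hak : a.1.testBit k
        · exact hrest k hak hk
        · rw [ha k (Or.inl hak), ham k hak]

theorem nodup_leaves {s : List (ℕ × ℕ)} (hs : Ordered s) {m : ℕ} (hm : ∀ p ∈ s, p.1 &&& m = 0) :
    (leaves s m).Nodup := by
  induction s generalizing m with
  | nil => exact List.nodup_singleton m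
  | cons a s ih =>
    obtain ⟨hne, hpw⟩ := hs
    rw [List.pairwise_cons] at hpw
    have hs' : Ordered s := ⟨fun p hp => hne p (List.mem_cons_of_mem _ hp), hpw.2⟩
    have hm1 : ∀ p ∈ s, p.1 &&& m = 0 := fun p hp => hm p (List.mem_cons_of_mem _ hp)
    have hm2 : ∀ p ∈ s, p.1 &&& (m ||| a.1) = 0 := by
      intro p hp
      refine land_eq_zero_iff.2 fun k hk => ?_
      rw [Nat.testBit_or, land_eq_zero_iff.1 (hm1 p hp) k hk,
        land_eq_zero_iff.1 (hpw.1 p hp).1 k hk]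
      rfl
    rw [leaves_cons]
    split_ifs
    · refine (ih hs' hm2).append (ih hs' hm1) fun m' h1 h2 => ?_
      rw [mem_leaves hs' hm2] at h1
      rw [mem_leaves hs' hm1] at h2
      obtain ⟨k, hk⟩ := Nat.exists_testBit_of_ne_zero (hne a List.mem_cons_self)
      have hks : ∀ p ∈ s, p.1.testBit k = false := by
        intro p hp
        by_contra h
        rw [land_eq_zero_iff.1 (hpw.1 p hp).1 k (by simpa using h)] at hk
        exact Bool.false_ne_true hk
      have h3 := (h1.1 k hks).symm.trans (h2.1 k hks)
      rw [land_eq_zero_iff.1 (hm a List.mem_cons_self) k hk, Nat.testBit_or, hk,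
        Bool.or_true] at h3
      exact Bool.false_ne_true h3.symm
    · rw [List.append_nil]
      exact ih hs' hm2

/-- The action of `σ` on the points of the cube. -/
def permIndex {n : ℕ} (σ : Equiv.Perm (Fin n)) (k : ℕ) : ℕ :=
  Nat.ofBits fun i : Fin n => k.testBit (σ i)

theorem point_permIndex {n : ℕ} (σ : Equiv.Perm (Fin n)) (k : ℕ) :
    point n (permIndex σ k) = point n k ∘ σ :=
  point_ofBits _

/-- The bit mask with the given set of bits. -/
def maskOf (l : List ℕ) : ℕ := l.foldr (fun j m => Nat.lor (2 ^ j) m) 0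

theorem testBit_maskOf {l : List ℕ} {k : ℕ} : (maskOf l).testBit k = true ↔ k ∈ l := by
  induction l with
  | nil => simp [maskOf]
  | cons a l ih =>
    rw [List.mem_cons, ← ih]
    change (2 ^ a ||| maskOf l).testBit k = true ↔ _
    rw [Nat.testBit_or, Bool.or_eq_true, Nat.testBit_two_pow, decide_eq_true_iff, eq_comm]

/-- The points of an orbit, and the points below it. -/
def step (n : ℕ) (o : List ℕ) : ℕ × ℕ :=
  (maskOf o, maskOf (o.flatMap fun k => (List.range (2 ^ n)).filter fun j => leM j k))

/-- The lists in `l` are the orbits of `σ`. -/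
def IsOrbits {n : ℕ} (σ : Equiv.Perm (Fin n)) (l : List (List ℕ)) : Prop :=
  (∀ o ∈ l, o = List.iterate (permIndex σ) (o.headD 0) o.length ∧
    ∀ k ∈ o, k < 2 ^ n ∧ permIndex σ k ∈ o) ∧ ∀ k < 2 ^ n, ∃ o ∈ l, k ∈ o

instance {n : ℕ} (σ : Equiv.Perm (Fin n)) (l : List (List ℕ)) : Decidable (IsOrbits σ l) :=
  inferInstanceAs (Decidable (_ ∧ _))

theorem mem_leaves_iff {n : ℕ} {σ : Equiv.Perm (Fin n)} {l : List (List ℕ)} (hl : IsOrbits σ l)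
    {s : List (ℕ × ℕ)} (hs : l.map (step n) = s) (hord : Ordered s) {m : ℕ} :
    m ∈ leaves s 0 ↔ ∃ f : FM n σ, toMask f.1 = m := by
  subst hs
  rw [mem_leaves hord fun p _ => Nat.and_zero _]
  simp only [List.forall_mem_map, Nat.zero_testBit]
  have hdec : ∀ o : List ℕ, Decided m (step n o) ↔ (∀ k ∈ o, m.testBit k = true) ∨
      ∀ k, (k ∈ o ∨ ∃ k' ∈ o, k < 2 ^ n ∧ leM k k' = true) → m.testBit k = false := by
    intro o
    simp only [Decided, step, testBit_maskOf, List.mem_flatMap, List.mem_filter, List.mem_range]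
  simp only [hdec]
  constructor
  · rintro ⟨h1, h2⟩
    have hbit : ∀ k, m.testBit k = true → k < 2 ^ n := by
      intro k hk
      by_contra hlt
      rw [h1 k] at hk
      · exact Bool.false_ne_true hk
      · intro o ho
        rw [← Bool.not_eq_true, step, testBit_maskOf]
        exact fun h => hlt ((hl.1 o ho).2 k h).1
    have hval : ∀ k < 2 ^ n, m.testBit (Nat.ofBits (point n k)) = m.testBit k := fun k hk => by
      rw [ofBits_point hk]
    refine ⟨⟨fun x => m.testBit (Nat.ofBits x), fun x y hxy => ?_, fun x => ?_⟩, ?_⟩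
    · obtain ⟨j, hj, rfl⟩ := exists_point_eq x
      obtain ⟨k, hk, rfl⟩ := exists_point_eq y
      dsimp only
      rw [hval j hj, hval k hk]
      obtain ⟨o, ho, hko⟩ := hl.2 k hk
      rcases h2 o ho with h | h
      · rw [h k hko]
        exact Bool.le_true _
      · rw [h j (Or.inr ⟨k, hko, hj, (point_le_iff hj).1 hxy⟩)]
        exact Bool.false_le _
    · obtain ⟨k, hk, rfl⟩ := exists_point_eq x
      obtain ⟨o, ho, hko⟩ := hl.2 k hk
      have hp := ((hl.1 o ho).2 k hko).2
      dsimp only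
      rw [← point_permIndex, hval k hk, hval _ ((hl.1 o ho).2 _ hp).1]
      rcases h2 o ho with h | h
      · rw [h _ hp, h _ hko]
      · rw [h _ (Or.inl hp), h _ (Or.inl hko)]
    · refine Nat.eq_of_testBit_eq fun k => ?_
      rcases lt_or_ge k (2 ^ n) with hk | hk
      · exact (testBit_toMask _ hk).trans (hval k hk)
      · rw [testBit_toMask_of_le _ hk, eq_comm, ← Bool.not_eq_true]
        exact fun h => hk.not_gt (hbit k h)
  · rintro ⟨f, rfl⟩
    constructor
    · intro k hk
      refine testBit_toMask_of_le _ (not_lt.1 fun hlt => ?_)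
      obtain ⟨o, ho, hko⟩ := hl.2 k hlt
      have := hk o ho
      rw [step, testBit_maskOf.2 hko] at this
      exact Bool.false_ne_true this.symm
    · intro o ho
      have hconst : ∀ k ∈ o, f.1 (point n k) = f.1 (point n (o.headD 0)) := by
        intro k hk
        rw [(hl.1 o ho).1, List.mem_iterate] at hk
        obtain ⟨i, -, rfl⟩ := hk
        generalize o.headD 0 = k0
        induction i with
        | zero => rfl
        | succ i ih => rw [Function.iterate_succ_apply', point_permIndex, f.2.2, ih]
      have hlt : ∀ k ∈ o, k < 2 ^ n := fun k hk => ((hl.1 o ho).2 k hk).1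
      cases hf : f.1 (point n (o.headD 0))
      · right
        rintro k (hk | ⟨k', hk', hk, hle⟩)
        · rw [testBit_toMask _ (hlt k hk), hconst k hk, hf]
        · rw [testBit_toMask _ hk]
          have := f.2.1 ((point_le_iff hk).2 hle)
          rw [hconst k' hk', hf] at this
          exact le_bot_iff.1 this
      · left
        intro k hk
        rw [testBit_toMask _ (hlt k hk), hconst k hk, hf]

/-- `L` lists the masks of the elements of `FM n σ`. -/
def Lists {n : ℕ} (σ : Equiv.Perm (Fin n)) (L : List ℕ) : Prop :=
  L.Nodup ∧ ∀ m, m ∈ L ↔ ∃ f : FM n σ, toMask f.1 = m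

theorem lists_leaves {n : ℕ} {σ : Equiv.Perm (Fin n)} {l : List (List ℕ)} (hl : IsOrbits σ l)
    {s : List (ℕ × ℕ)} (hs : l.map (step n) = s) (hord : Ordered s) : Lists σ (leaves s 0) :=
  ⟨nodup_leaves hord fun _ _ => Nat.and_zero _, fun _ => mem_leaves_iff hl hs hord⟩

theorem Lists.sum_eq {n : ℕ} {σ : Equiv.Perm (Fin n)} {L : List ℕ} (hL : Lists σ L) (g : ℕ → ℕ) :
    ∑ f : FM n σ, g (toMask f.1) = (L.map g).sum := by
  classical
  rw [← List.sum_toFinset g hL.1]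
  have : L.toFinset = univ.image fun f : FM n σ => toMask f.1 := by
    ext m
    simp [hL.2]
  rw [this]
  exact (sum_image fun f _ g _ h => Subtype.ext (toMask_injective h)).symm

theorem Lists.card_eq {n : ℕ} {σ : Equiv.Perm (Fin n)} {L : List ℕ} (hL : Lists σ L) :
    Fintype.card (FM n σ) = (L.map fun _ => 1).sum := by
  rw [← hL.sum_eq, Fintype.card_eq_sum_ones]

theorem card_eq_sumLeaves {n : ℕ} {σ : Equiv.Perm (Fin n)} {l : List (List ℕ)}
    (hl : IsOrbits σ l) {s : List (ℕ × ℕ)} (hs : l.map (step n) = s) (hord : Ordered s) :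
    Fintype.card (FM n σ) = sumLeaves (fun _ => 1) s 0 := by
  rw [sumLeaves_eq, (lists_leaves hl hs hord).card_eq]

end Enumeration

section Packed

/-- The sum of the values of `f` over a list. -/
noncomputable def sumMap (f : ℕ → ℕ) (l : List ℕ) : ℕ :=
  List.rec 0 (fun a _ ih => Nat.add (f a) ih) l

/-- The sum of the values of `f` over the elements of a list which satisfy `p`. -/
noncomputable def sumIf (p : ℕ → Bool) (f : ℕ → ℕ) (l : List ℕ) : ℕ :=
  List.rec 0 (fun a _ ih => Bool.rec ih (Nat.add (f a) ih) (p a)) l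

/-- The elements of a list which satisfy `p`. -/
noncomputable def sublist (p : ℕ → Bool) (l : List ℕ) : List ℕ :=
  List.rec [] (fun a _ ih => Bool.rec ih (a :: ih) (p a)) l

/-- The number whose digits in base `2 ^ 48` are the values of `f`. -/
noncomputable def pack (f : ℕ → ℕ) (l : List ℕ) : ℕ :=
  List.rec 0 (fun a _ ih => Nat.add (f a) (Nat.mul 281474976710656 ih)) l

/-- `x` or zero. -/
noncomputable def keepIf (b : Bool) (x : ℕ) : ℕ := Bool.rec 0 x b

/-- The sum of the squares of the values of `f` over `l`, if `V` packs the values of `f` over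
`l ++ l.reverse` and `Y` is `2 ^ (48 * l.length)`. -/
noncomputable def squares (Y V : ℕ) : ℕ :=
  Nat.mod (Nat.div (Nat.mul 281474976710656 (Nat.mul (Nat.mod V Y) (Nat.div V Y))) Y)
    281474976710656

theorem sumMap_eq (f : ℕ → ℕ) (l : List ℕ) : sumMap f l = (l.map f).sum := by
  induction l with
  | nil => rfl
  | cons a l ih => exact congrArg (f a + ·) ih

theorem sumIf_cons (p : ℕ → Bool) (f : ℕ → ℕ) (a : ℕ) (l : List ℕ) :
    sumIf p f (a :: l) = keepIf (p a) (f a) + sumIf p f l := by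
  change @Bool.rec (fun _ => ℕ) (sumIf p f l) (f a + sumIf p f l) (p a) = _
  cases p a
  · exact (Nat.zero_add _).symm
  · rfl

theorem keepIf_eq (b : Bool) (x : ℕ) : keepIf b x = if b = true then x else 0 := by
  cases b <;> rfl

theorem sumIf_eq (p : ℕ → Bool) (f : ℕ → ℕ) (l : List ℕ) :
    sumIf p f l = (l.map fun a => if p a = true then f a else 0).sum := by
  induction l with
  | nil => rfl
  | cons a l ih => rw [sumIf_cons, ih, keepIf_eq, List.map_cons, List.sum_cons]

theorem sublist_eq (p : ℕ → Bool) (l : List ℕ) : sublist p l = l.filter p := by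
  induction l with
  | nil => rfl
  | cons a l ih =>
    change @Bool.rec (fun _ => List ℕ) (sublist p l) (a :: sublist p l) (p a) = _
    rw [ih]
    cases h : p a <;> simp [h]

theorem sum_map_filter (p : ℕ → Bool) (f : ℕ → ℕ) (l : List ℕ) :
    ((l.filter p).map f).sum = (l.map fun a => if p a = true then f a else 0).sum := by
  induction l with
  | nil => rfl
  | cons a l ih => cases h : p a <;> simp [h, ih]

theorem pack_cons (f : ℕ → ℕ) (a : ℕ) (l : List ℕ) :
    pack f (a :: l) = f a + 2 ^ 48 * pack f l := rfl

theorem pack_add (f g : ℕ → ℕ) (l : List ℕ) :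
    pack (fun a => f a + g a) l = pack f l + pack g l := by
  induction l with
  | nil => rfl
  | cons a l ih =>
    simp only [pack_cons, ih]
    ring

theorem pack_zero (l : List ℕ) : pack (fun _ => 0) l = 0 := by
  induction l with
  | nil => rfl
  | cons a l ih => rw [pack_cons, ih, Nat.zero_add, Nat.mul_zero]

theorem sumIf_pack (p : ℕ → Bool) (f : ℕ → ℕ → ℕ) (l l' : List ℕ) :
    sumIf p (fun y => pack (f y) l') l = pack (fun c => sumIf p (fun y => f y c) l) l' := by
  induction l with
  | nil => exact (pack_zero l').symm
  | cons a l ih =>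
    simp only [sumIf_cons, ih, pack_add]
    cases p a
    · exact congrArg (· + _) (pack_zero l').symm
    · rfl

theorem pack_land {p : ℕ → Bool} {f : ℕ → ℕ} {l : List ℕ} (hf : ∀ a ∈ l, f a < 2 ^ 48) :
    Nat.land (pack (fun a => keepIf (p a) 281474976710655) l) (pack f l) =
      pack (fun a => keepIf (p a) (f a)) l := by
  change (_ &&& _ : ℕ) = _
  induction l with
  | nil => exact Nat.zero_and _
  | cons a l ih =>
    rw [List.forall_mem_cons] at hf
    simp only [pack_cons, ← ih hf.2]
    have hk : keepIf (p a) 281474976710655 < 2 ^ 48 := by cases p a <;> norm_num [keepIf]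
    have hl : keepIf (p a) 281474976710655 &&& f a = keepIf (p a) (f a) := by
      cases p a
      · exact Nat.zero_and _
      · change (2 ^ 48 - 1) &&& f a = f a
        rw [Nat.and_comm, Nat.and_two_pow_sub_one_eq_mod, Nat.mod_eq_of_lt hf.1]
    rw [← Nat.mod_add_div ((keepIf (p a) 281474976710655 + _) &&& (f a + _)) (2 ^ 48),
      Nat.and_mod_two_pow, Nat.and_div_two_pow]
    simp only [Nat.add_mul_mod_self_left, Nat.mod_eq_of_lt hk, Nat.mod_eq_of_lt hf.1, hl,
      Nat.add_mul_div_left _ _ (Nat.two_pow_pos 48), Nat.div_eq_of_lt hk, Nat.div_eq_of_lt hf.1,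
      Nat.zero_add]

theorem pack_append (f : ℕ → ℕ) (l l' : List ℕ) :
    pack f (l ++ l') = pack f l + (2 ^ 48) ^ l.length * pack f l' := by
  induction l with
  | nil => simp [pack]
  | cons a l ih =>
    rw [List.cons_append, pack_cons, ih, pack_cons, List.length_cons]
    ring

theorem pack_lt {f : ℕ → ℕ} {l : List ℕ} (hf : ∀ a ∈ l, f a < 2 ^ 48) :
    pack f l < (2 ^ 48) ^ l.length := by
  induction l with
  | nil => exact Nat.one_pos
  | cons a l ih =>
    rw [List.forall_mem_cons] at hf
    rw [pack_cons, List.length_cons, pow_succ (2 ^ 48 : ℕ)]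
    have := ih hf.2
    have := hf.1
    generalize (2 ^ 48 : ℕ) ^ l.length = Y at *
    omega

theorem pack_reverse_le (f : ℕ → ℕ) (l : List ℕ) :
    2 ^ 48 * pack f l.reverse ≤ (l.map f).sum * (2 ^ 48) ^ l.length := by
  induction l with
  | nil => simp [pack]
  | cons a l ih =>
    rw [List.reverse_cons, pack_append, List.length_reverse, List.map_cons, List.sum_cons,
      List.length_cons]
    have : pack f [a] = f a := rfl
    rw [this, pow_succ (2 ^ 48 : ℕ)]
    generalize (2 ^ 48 : ℕ) ^ l.length = Y at *
    nlinarith [Nat.zero_le ((l.map f).sum * Y)]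

theorem pack_mul_pack_reverse (f : ℕ → ℕ) (l : List ℕ) :
    ∃ low high, 2 ^ 48 * (pack f l * pack f l.reverse) =
      low + (2 ^ 48) ^ l.length * ((l.map fun a => f a ^ 2).sum + 2 ^ 48 * high) ∧
      2 ^ 48 * low ≤ (l.map f).sum ^ 2 * (2 ^ 48) ^ l.length := by
  induction l with
  | nil => exact ⟨0, 0, by simp [pack], by simp⟩
  | cons a l ih =>
    obtain ⟨low, high, h1, h2⟩ := ih
    have hR := pack_reverse_le f l
    have ha : pack f [a] = f a := rfl
    rw [List.reverse_cons, pack_append, pack_cons, List.length_reverse, List.map_cons,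
      List.sum_cons, List.map_cons, List.sum_cons, List.length_cons, ha, pow_succ (2 ^ 48 : ℕ)]
    refine ⟨2 ^ 48 * (f a * pack f l.reverse + low), high + pack f l * f a, ?_, ?_⟩
    · linear_combination 2 ^ 48 * h1
    · have h3 := Nat.mul_le_mul_left (f a) hR
      generalize (2 ^ 48 : ℕ) ^ l.length = Y at *
      have h4 : 2 ^ 48 * (f a * pack f l.reverse + low) ≤ (f a + (l.map f).sum) ^ 2 * Y := by
        nlinarith [Nat.zero_le (f a * (l.map f).sum * Y), Nat.zero_le (f a ^ 2 * Y)]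
      nlinarith

theorem sum_sq_le (l : List ℕ) : (l.map (· ^ 2)).sum ≤ l.sum ^ 2 := by
  induction l with
  | nil => exact le_rfl
  | cons a l ih =>
    rw [List.map_cons, List.sum_cons, List.sum_cons]
    nlinarith [Nat.zero_le (a * l.sum)]

theorem squares_pack {f : ℕ → ℕ} {l : List ℕ} (hf : (l.map f).sum ^ 2 < 2 ^ 48) :
    squares ((2 ^ 48) ^ l.length) (pack f (l ++ l.reverse)) = (l.map fun a => f a ^ 2).sum := by
  have hlt : ∀ a ∈ l, f a < 2 ^ 48 := fun a ha =>
    ((List.single_le_sum (fun _ _ => Nat.zero_le _) _ (List.mem_map_of_mem ha)).trans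
      (Nat.le_self_pow two_ne_zero _)).trans_lt hf
  have hlt' := pack_lt hlt
  have hsq : (l.map fun a => f a ^ 2).sum < 2 ^ 48 := by
    refine lt_of_le_of_lt ?_ hf
    have := sum_sq_le (l.map f)
    rwa [List.map_map] at this
  obtain ⟨low, high, h1, h2⟩ := pack_mul_pack_reverse f l
  have hY : 0 < (2 ^ 48 : ℕ) ^ l.length := by positivity
  change 2 ^ 48 * (pack f (l ++ l.reverse) % _ * (pack f (l ++ l.reverse) / _)) / _ % 2 ^ 48 = _
  rw [pack_append, Nat.add_mul_mod_self_left, Nat.add_mul_div_left _ _ hY, Nat.mod_eq_of_lt hlt',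
    Nat.div_eq_of_lt hlt', Nat.zero_add, h1, Nat.add_mul_div_left _ _ hY, Nat.div_eq_of_lt,
    Nat.zero_add, Nat.add_mul_mod_self_left, Nat.mod_eq_of_lt hsq]
  have := h2.trans_lt (Nat.mul_lt_mul_of_pos_right hf hY)
  exact lt_of_mul_lt_mul_left this (Nat.zero_le _)

end Packed

section Cube

/-- For each `c` in `l'`, the number of `y` in `l` above both `x` and `c`. -/
noncomputable def above (l l' : List ℕ) (x : ℕ) : ℕ :=
  sumIf (leM x) (fun y => pack (fun c => keepIf (leM c y) 1) l') l

/-- The computation behind `cubeSum`, for `l' = l ++ l.reverse` and `Y = 2 ^ (48 * l.length)`. -/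
noncomputable def cubeSumAux (l l' : List ℕ) (Y : ℕ) : ℕ :=
  sumMap (fun a => (fun l₁ => sumMap (fun b => squares Y (Nat.land
    (pack (fun c => keepIf (leM a c) 281474976710655) l')
    (sumIf (fun x => leM x b) (above l l') l₁))) l₁) (sublist (leM a) l)) l

/-- `cubeCount`, computed with lists of masks. -/
noncomputable def cubeSum (L : List ℕ) (t : ℕ) : ℕ :=
  (fun l => cubeSumAux l (append l l.reverse)
    (Nat.pow 281474976710656 (sumMap (fun _ => 1) l))) (sublist (fun a => leM a t) L)

theorem sum_map_le {l : List ℕ} {f : ℕ → ℕ} {B : ℕ} (h : ∀ a ∈ l, f a ≤ B) :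
    (l.map f).sum ≤ l.length * B := by
  have := List.sum_le_card_nsmul (l.map f) B (by simpa using h)
  simpa using this

theorem sumIf_le {l : List ℕ} {p : ℕ → Bool} {f : ℕ → ℕ} {B : ℕ} (h : ∀ a, f a ≤ B) :
    sumIf p f l ≤ l.length * B := by
  rw [sumIf_eq]
  refine sum_map_le fun a _ => ?_
  split_ifs
  · exact h a
  · exact Nat.zero_le _

theorem keepIf_le (b : Bool) (x : ℕ) : keepIf b x ≤ x := by
  cases b
  · exact Nat.zero_le _
  · exact le_rfl

theorem cubeSumAux_eq {l : List ℕ} (hl : l.length < 2 ^ 8) :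
    cubeSumAux l (l ++ l.reverse) ((2 ^ 48) ^ l.length) =
      (l.map fun a => ((l.filter (leM a)).map fun b => ((l.filter (leM a)).map fun c =>
        (sumIf (fun x => leM x b) (fun x => sumIf (leM x) (fun y => keepIf (leM c y) 1) l)
          (l.filter (leM a))) ^ 2).sum).sum).sum := by
  unfold cubeSumAux
  rw [sumMap_eq]
  refine congrArg List.sum (List.map_congr_left fun a _ => ?_)
  dsimp only
  rw [sumMap_eq, sublist_eq]
  refine congrArg List.sum (List.map_congr_left fun b _ => ?_)
  have hv : ∀ c, sumIf (fun x => leM x b)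
      (fun x => sumIf (leM x) (fun y => keepIf (leM c y) 1) l) (l.filter (leM a)) < 2 ^ 16 := by
    intro c
    have h1 : sumIf (fun x => leM x b) (fun x => sumIf (leM x) (fun y => keepIf (leM c y) 1) l)
        (l.filter (leM a)) ≤ (l.filter (leM a)).length * (l.length * 1) :=
      sumIf_le fun x => sumIf_le fun y => keepIf_le _ _
    have h2 := List.length_filter_le (leM a) l
    nlinarith
  have habove : above l (l ++ l.reverse) = fun x => pack (fun c =>
      sumIf (leM x) (fun y => keepIf (leM c y) 1) l) (l ++ l.reverse) :=
    funext fun x => sumIf_pack _ _ _ _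
  rw [habove, sumIf_pack, pack_land fun c _ => (hv c).trans (by norm_num), squares_pack,
    sum_map_filter]
  · refine congrArg List.sum (List.map_congr_left fun c _ => ?_)
    rw [keepIf_eq, ite_pow, zero_pow two_ne_zero]
  · have := sum_map_le (l := l) (f := fun c => keepIf (leM a c) (sumIf (fun x => leM x b)
      (fun x => sumIf (leM x) (fun y => keepIf (leM c y) 1) l) (l.filter (leM a)))) (B := 2 ^ 16)
      fun c _ => (keepIf_le _ _).trans (hv c).le
    calc _ ≤ (l.length * 2 ^ 16) ^ 2 := Nat.pow_le_pow_left this 2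
      _ < (2 ^ 8 * 2 ^ 16) ^ 2 := Nat.pow_lt_pow_left (by omega) two_ne_zero
      _ = 2 ^ 48 := by norm_num

theorem cubeSum_eq_cubeCount {n : ℕ} {σ : Equiv.Perm (Fin n)} {L : List ℕ} (hL : Lists σ L)
    (hlen : L.length < 2 ^ 8) (t : FM n σ) : cubeSum L (toMask t.1) = cubeCount t := by
  classical
  have hlen' : (L.filter fun a => leM a (toMask t.1)).length < 2 ^ 8 :=
    (List.length_filter_le _ L).trans_lt hlen
  have h1 : cubeSum L (toMask t.1) = cubeSumAux (L.filter fun a => leM a (toMask t.1))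
      ((L.filter fun a => leM a (toMask t.1)) ++ (L.filter fun a => leM a (toMask t.1)).reverse)
      ((2 ^ 48) ^ (L.filter fun a => leM a (toMask t.1)).length) := by
    unfold cubeSum
    rw [sublist_eq]
    dsimp only
    rw [append_eq, sumMap_eq, List.map_const', List.sum_replicate]
    simp
  rw [h1, cubeSumAux_eq hlen']
  simp only [sumIf_eq, sum_map_filter, keepIf_eq, ← hL.sum_eq]
  have hle : ∀ f g : FM n σ, leM (toMask f.1) (toMask g.1) = true ↔ f ≤ g :=
    fun f g => leM_toMask_iff.trans FM.le_iff.symm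
  simp only [cubeCount, ite_and]
  exact sum_congr rfl fun a _ => if_congr (hle a t) (sum_congr rfl fun b _ =>
    if_congr (hle b t) (if_congr (hle a b) (sum_congr rfl fun c _ => if_congr (hle c t)
      (if_congr (hle a c) (congrArg (· ^ 2) (sum_congr rfl fun x _ => if_congr (hle x t)
        (if_congr (hle a x) (if_congr (hle x b) (sum_congr rfl fun y _ => if_congr (hle y t)
          (if_congr (hle x y) (if_congr (hle c y) rfl rfl) rfl) rfl) rfl) rfl) rfl)) rfl) rfl)
      rfl) rfl) rfl

end Cube

/-- The permutation which fixes the first three variables and acts as `τ` on the others. -/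
def fixThree {n : ℕ} (τ : Equiv.Perm (Fin n)) : Equiv.Perm (Fin (n + 3)) :=
  Equiv.Perm.decomposeFin.symm (0, Equiv.Perm.decomposeFin.symm
    (0, Equiv.Perm.decomposeFin.symm (0, τ)))

theorem card_fixThree {n : ℕ} {τ : Equiv.Perm (Fin n)} {L : List ℕ} (hL : Lists τ L)
    (hlen : L.length < 2 ^ 8) :
    Fintype.card (FM (n + 3) (fixThree τ)) = sumMap (cubeSum L) L := by
  classical
  have e {m : ℕ} (τ : Equiv.Perm (Fin m)) :
      FM (m + 1) (Equiv.Perm.decomposeFin.symm (0, τ)) ≃o OrderedPair (FM m τ) :=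
    splitFixed (by simp) fun i => by simp
  have e3 := (e _).trans (orderedPairCongr ((e _).trans (orderedPairCongr (e τ))))
  rw [sumMap_eq, ← hL.sum_eq]
  refine (Fintype.card_congr e3.toEquiv).trans (card_cube.trans ?_)
  exact sum_congr rfl fun t _ => (cubeSum_eq_cubeCount hL hlen t).symm

/-- Renaming of variables, for truth tables. -/
def permMask {n : ℕ} (p : Equiv.Perm (Fin n)) (m : ℕ) : ℕ :=
  maskOf ((List.range (2 ^ n)).filter fun k => m.testBit (permIndex p k))

/-- Renaming of variables, as an order isomorphism. -/
def renameIso {n : ℕ} (p : Equiv.Perm (Fin n)) : FM n 1 ≃o FM n 1 where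
  toFun f := ⟨fun x => f.1 (x ∘ p), monotone_comp_perm f.2.1 p, fun _ => rfl⟩
  invFun f := ⟨fun x => f.1 (x ∘ p.symm), monotone_comp_perm f.2.1 p.symm, fun _ => rfl⟩
  left_inv f := Subtype.ext <| funext fun x => congrArg f.1 <| funext fun i => by simp
  right_inv f := Subtype.ext <| funext fun x => congrArg f.1 <| funext fun i => by simp
  map_rel_iff' {f g} := by
    simp only [FM.le_iff]
    refine ⟨fun h x => ?_, fun h x => h _⟩
    have := h (x ∘ p.symm)
    have hx : (x ∘ p.symm) ∘ p = x := funext fun i => by simp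
    change f.1 ((x ∘ p.symm) ∘ p) ≤ g.1 ((x ∘ p.symm) ∘ p) at this
    rwa [hx] at this

theorem permIndex_lt {n : ℕ} (p : Equiv.Perm (Fin n)) (k : ℕ) : permIndex p k < 2 ^ n :=
  Nat.ofBits_lt_two_pow _

theorem toMask_renameIso {n : ℕ} (p : Equiv.Perm (Fin n)) (f : FM n 1) :
    toMask (renameIso p f).1 = permMask p (toMask f.1) := by
  refine Nat.eq_of_testBit_eq fun k => Bool.eq_iff_iff.2 ?_
  rw [permMask, testBit_maskOf, List.mem_filter, List.mem_range,
    testBit_toMask _ (permIndex_lt p k), point_permIndex]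
  rcases lt_or_ge k (2 ^ n) with hk | hk
  · rw [testBit_toMask _ hk]
    exact ⟨fun h => ⟨hk, h⟩, fun h => h.2⟩
  · rw [testBit_toMask_of_le _ hk]
    exact ⟨fun h => absurd h Bool.false_ne_true, fun h => absurd h.1 hk.not_gt⟩

theorem cubeSum_permMask {n : ℕ} {L : List ℕ} (hL : Lists (1 : Equiv.Perm (Fin n)) L)
    (hlen : L.length < 2 ^ 8) (p : Equiv.Perm (Fin n)) {m : ℕ} (hm : m ∈ L) :
    cubeSum L (permMask p m) = cubeSum L m := by
  obtain ⟨f, rfl⟩ := (hL.2 m).1 hm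
  rw [← toMask_renameIso, cubeSum_eq_cubeCount hL hlen, cubeSum_eq_cubeCount hL hlen,
    cubeCount_apply_orderIso]

/-- Evaluation of the sum of `cubeSum` by symmetry: `c` consists of representatives, the values of
`cubeSum` there, and codes of renamings which produce the orbits of the representatives. -/
theorem sum_cubeSum_eq {n : ℕ} {L : List ℕ} (hL : Lists (1 : Equiv.Perm (Fin n)) L)
    (hlen : L.length < 2 ^ 8) (π : ℕ → Equiv.Perm (Fin n)) (c : List (ℕ × ℕ × List ℕ))
    (hval : ∀ q ∈ c, Evaluates (cubeSum L q.1) q.2.1) (hmem : ∀ q ∈ c, q.1 ∈ L)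
    (hperm : L.Perm (c.flatMap fun q => q.2.2.map fun i => permMask (π i) q.1)) :
    sumMap (cubeSum L) L = (c.map fun q => q.2.2.length * q.2.1).sum := by
  rw [sumMap_eq, (hperm.map _).sum_eq]
  clear hperm
  induction c with
  | nil => rfl
  | cons q c ih =>
    rw [List.forall_mem_cons] at hval hmem
    rw [List.flatMap_cons, List.map_append, List.sum_append, ih hval.2 hmem.2, List.map_cons,
      List.sum_cons, List.map_map]
    congr 1
    have h : q.2.2.map (cubeSum L ∘ fun i => permMask (π i) q.1) = q.2.2.map fun _ => q.2.1 :=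
      List.map_congr_left fun i _ =>
        (cubeSum_permMask hL hlen (π i) hmem.1).trans hval.1.eq
    rw [h, List.map_const', List.sum_replicate, smul_eq_mul]

section Swap

/-- The number of elements of a list which satisfy `p`, from the packed form of `p`. -/
theorem pack_mod {p : ℕ → Bool} {l : List ℕ} (hl : l.length < 281474976710655) :
    Nat.mod (pack (fun a => keepIf (p a) 1) l) 281474976710655 =
      (l.map fun a => if p a = true then 1 else 0).sum := by
  have h : pack (fun a => keepIf (p a) 1) l ≡ (l.map fun a => if p a = true then 1 else 0).sum
      [MOD 281474976710655] := by
    clear hl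
    induction l with
    | nil => rfl
    | cons a l ih =>
      rw [pack_cons, List.map_cons, List.sum_cons, keepIf_eq]
      refine Nat.ModEq.add_left _ ?_
      simpa using Nat.ModEq.mul (show 2 ^ 48 ≡ 1 [MOD 281474976710655] by rfl) ih
  have hle := sum_map_le (l := l) (f := fun a => if p a = true then 1 else 0) (B := 1)
    fun a _ => by split_ifs <;> simp
  exact Eq.trans h (Nat.mod_eq_of_lt (by omega))

/-- The sum, over the masks `w` of `leaves s m`, of the number of pairs `(u, v)` of elements of `L`
with `u` below and `v` above `w`; the sets of candidates for `u` and `v` are packed into `U` and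
`V`. -/
noncomputable def sumPairs (L : List ℕ) (s : List (ℕ × ℕ)) : ℕ → ℕ → ℕ → ℕ :=
  List.rec (fun _ U V => Nat.mul (Nat.mod U 281474976710655) (Nat.mod V 281474976710655))
    (fun a _ ih m U V => Nat.add
      (ih (Nat.lor m a.1) U
        (Nat.land (pack (fun v => keepIf (leM a.1 v) 281474976710655) L) V))
      (Bool.rec 0 (ih m
        (Nat.land (pack (fun u => keepIf (Nat.beq (Nat.land u a.1) 0) 281474976710655) L) U) V)
        (Nat.beq (Nat.land m a.2) 0))) s

theorem keepIf_keepIf (p q : Bool) (x : ℕ) : keepIf p (keepIf q x) = keepIf (p && q) x := by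
  cases p <;> rfl

theorem pack_land_indicator {p q : ℕ → Bool} {l : List ℕ} :
    Nat.land (pack (fun a => keepIf (p a) 281474976710655) l) (pack (fun a => keepIf (q a) 1) l) =
      pack (fun a => keepIf (p a && q a) 1) l := by
  rw [pack_land fun a _ => (keepIf_le _ _).trans_lt (by norm_num)]
  simp only [keepIf_keepIf]

theorem leM_of_mem_leaves {s : List (ℕ × ℕ)} {m w : ℕ} (hw : w ∈ leaves s m) : leM m w = true := by
  induction s generalizing m with
  | nil =>
    rw [List.mem_singleton.1 hw, leM_iff]
    exact fun _ h => h
  | cons a s ih =>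
    rw [leaves_cons, List.mem_append] at hw
    rcases hw with hw | hw
    · refine leM_iff.2 fun k hk => leM_iff.1 (ih hw) k ?_
      rw [Nat.testBit_or, hk, Bool.true_or]
    · split_ifs at hw
      · exact ih hw
      · exact absurd hw List.not_mem_nil

/-- Compatibility of `u` with a lower bound for `w`, on the sets of `s`. -/
def below (s : List (ℕ × ℕ)) (w u : ℕ) : Bool :=
  s.all fun a => leM a.1 w || Nat.beq (Nat.land u a.1) 0

/-- Compatibility of `v` with an upper bound for `w`, on the sets of `s`. -/
def beyond (s : List (ℕ × ℕ)) (w v : ℕ) : Bool :=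
  s.all fun a => !leM a.1 w || leM a.1 v

theorem below_cons (a : ℕ × ℕ) (s : List (ℕ × ℕ)) (w u : ℕ) :
    below (a :: s) w u = ((leM a.1 w || Nat.beq (Nat.land u a.1) 0) && below s w u) := rfl

theorem beyond_cons (a : ℕ × ℕ) (s : List (ℕ × ℕ)) (w v : ℕ) :
    beyond (a :: s) w v = ((!leM a.1 w || leM a.1 v) && beyond s w v) := rfl

theorem sumPairs_eq {L : List ℕ} (hL : L.length < 281474976710655) {s : List (ℕ × ℕ)}
    (hs : Ordered s) {m : ℕ} (hm : ∀ p ∈ s, p.1 &&& m = 0) (p q : ℕ → Bool) :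
    sumPairs L s m (pack (fun u => keepIf (p u) 1) L) (pack (fun v => keepIf (q v) 1) L) =
      ((leaves s m).map fun w =>
        (L.map fun u => if (below s w u && p u) = true then 1 else 0).sum *
          (L.map fun v => if (beyond s w v && q v) = true then 1 else 0).sum).sum := by
  induction s generalizing m p q with
  | nil =>
    change Nat.mod _ _ * Nat.mod _ _ = _
    rw [pack_mod hL, pack_mod hL]
    exact List.sum_singleton.symm
  | cons a s ih =>
    have ham := hm a List.mem_cons_self
    have hne := hs.1 a List.mem_cons_self
    have hpw := List.pairwise_cons.1 hs.2
    have hs' : Ordered s := ⟨fun p hp => hs.1 p (List.mem_cons_of_mem _ hp), hpw.2⟩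
    have hm1 : ∀ p ∈ s, p.1 &&& m = 0 := fun p hp => hm p (List.mem_cons_of_mem _ hp)
    have hm2 : ∀ p ∈ s, p.1 &&& (m ||| a.1) = 0 := fun p hp => by
      rw [Nat.and_or_distrib_left, hm1 p hp, (hpw.1 p hp).1]
      rfl
    have h1 : ∀ w ∈ leaves s (m ||| a.1), leM a.1 w = true := fun w hw =>
      leM_iff.2 fun k hk => leM_iff.1 (leM_of_mem_leaves hw) k <| by
        rw [Nat.testBit_or, hk, Bool.or_true]
    have h2 : ∀ w ∈ leaves s m, leM a.1 w = false := by
      intro w hw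
      rw [← Bool.not_eq_true]
      intro h
      obtain ⟨k, hk⟩ := Nat.exists_testBit_of_ne_zero hne
      have hks : ∀ p ∈ s, p.1.testBit k = false := by
        intro p hp
        by_contra h
        rw [land_eq_zero_iff.1 (hpw.1 p hp).1 k (by simpa using h)] at hk
        exact Bool.false_ne_true hk
      have := ((mem_leaves hs' hm1).1 hw).1 k hks
      rw [leM_iff.1 h k hk, land_eq_zero_iff.1 ham k hk] at this
      exact Bool.false_ne_true this.symm
    rw [leaves_cons, List.map_append, List.sum_append]
    refine congrArg₂ (fun x y : ℕ => x + y) ?_ ?_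
    · change sumPairs L s (m ||| a.1) _ (Nat.land _ _) = _
      rw [pack_land_indicator, ih hs' hm2]
      refine congrArg List.sum (List.map_congr_left fun w hw => ?_)
      refine congrArg₂ (fun x y : ℕ => x * y) ?_ ?_ <;>
        refine congrArg List.sum (List.map_congr_left fun u _ => ?_) <;>
        simp only [below_cons, beyond_cons, h1 w hw, Bool.true_or, Bool.not_true, Bool.false_or,
          Bool.true_and, Bool.and_left_comm, Bool.and_assoc]
    · change @Bool.rec (fun _ => ℕ) 0 (sumPairs L s m (Nat.land _ _) _) (Nat.beq (m &&& a.2) 0) = _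
      split_ifs with h
      · rw [beq_iff.2 h, pack_land_indicator]
        change sumPairs L s m _ _ = _
        rw [ih hs' hm1]
        refine congrArg List.sum (List.map_congr_left fun w hw => ?_)
        refine congrArg₂ (fun x y : ℕ => x * y) ?_ ?_ <;>
          refine congrArg List.sum (List.map_congr_left fun u _ => ?_) <;>
          simp only [below_cons, beyond_cons, h2 w hw, Bool.true_or, Bool.not_false, Bool.false_or,
            Bool.true_and, Bool.and_left_comm, Bool.and_assoc]
      · rw [Bool.eq_false_iff.2 fun h' => h (beq_iff.1 h')]
        rfl

/-- Counting along a pair of exchanged variables. -/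
theorem card_of_swap {n : ℕ} {σ : Equiv.Perm (Fin (n + 2))} {τ : Equiv.Perm (Fin n)}
    (h0 : σ 0 = 1) (h1 : σ 1 = 0) (hs : ∀ i : Fin n, σ i.succ.succ = (τ i).succ.succ)
    {L : List ℕ} (hL : Lists τ L) (hlen : L.length < 281474976710655) {l : List (List ℕ)}
    (hl : IsOrbits (τ * τ) l) {s : List (ℕ × ℕ)} (hsl : l.map (step n) = s) (hord : Ordered s) :
    Fintype.card (FM (n + 2) σ) =
      sumPairs L s 0 (pack (fun _ => 1) L) (pack (fun _ => 1) L) := by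
  classical
  have hs2 := lists_leaves hl hsl hord
  have hcover : ∀ k < 2 ^ n, ∃ a ∈ s, a.1.testBit k = true := by
    intro k hk
    obtain ⟨o, ho, hko⟩ := hl.2 k hk
    exact ⟨step n o, hsl ▸ List.mem_map_of_mem ho, testBit_maskOf.2 hko⟩
  have hdec : ∀ w : FM n (τ * τ), ∀ a ∈ s, Decided (toMask w.1) a := fun w =>
    ((mem_leaves hord fun _ _ => Nat.and_zero _).1 ((hs2.2 _).2 ⟨w, rfl⟩)).2
  have hlow : ∀ w : FM n (τ * τ), ∀ u : FM n τ,
      below s (toMask w.1) (toMask u.1) = true ↔ ∀ x, u.1 x ≤ w.1 x := by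
    intro w u
    rw [← leM_toMask_iff, below, List.all_eq_true, leM_iff]
    simp only [Bool.or_eq_true, beq_iff]
    constructor
    · intro h k hk
      have hkn : k < 2 ^ n := not_le.1 fun hkn =>
        Bool.false_ne_true ((testBit_toMask_of_le _ hkn).symm.trans hk)
      obtain ⟨a, ha, hak⟩ := hcover k hkn
      rcases h a ha with h | h
      · exact leM_iff.1 h k hak
      · exact absurd ((land_eq_zero_iff.1 h k hk).symm.trans hak) Bool.false_ne_true
    · intro h a ha
      rcases hdec w a ha with hd | hd
      · exact Or.inl (leM_iff.2 hd)
      · refine Or.inr (land_eq_zero_iff.2 fun k hk => ?_)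
        by_contra hak
        exact Bool.false_ne_true ((hd k (Or.inl (by simpa using hak))).symm.trans (h k hk))
  have hup : ∀ w : FM n (τ * τ), ∀ v : FM n τ,
      beyond s (toMask w.1) (toMask v.1) = true ↔ ∀ x, w.1 x ≤ v.1 x := by
    intro w v
    rw [← leM_toMask_iff, beyond, List.all_eq_true, leM_iff]
    simp only [Bool.or_eq_true, Bool.not_eq_true', ← Bool.not_eq_true, ← imp_iff_not_or]
    constructor
    · intro h k hk
      have hkn : k < 2 ^ n := not_le.1 fun hkn =>
        Bool.false_ne_true ((testBit_toMask_of_le _ hkn).symm.trans hk)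
      obtain ⟨a, ha, hak⟩ := hcover k hkn
      rcases hdec w a ha with hd | hd
      · exact leM_iff.1 (h a ha (leM_iff.2 hd)) k hak
      · exact absurd ((hd k (Or.inl hak)).symm.trans hk) Bool.false_ne_true
    · exact fun h a _ haw => leM_iff.2 fun k hk => h k (leM_iff.1 haw k hk)
  have hsum := sumPairs_eq hlen hord (m := 0) (fun _ _ => Nat.and_zero _) (fun _ => true)
    fun _ => true
  refine Eq.trans ?_ hsum.symm
  rw [Fintype.card_congr (splitSwap h0 h1 hs), Fintype.card_sigma, ← hs2.sum_eq]
  refine sum_congr rfl fun w _ => ?_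
  rw [Fintype.card_prod]
  refine congrArg₂ (· * ·) ?_ ?_
  · rw [← hL.sum_eq, Fintype.card_subtype, card_filter]
    refine sum_congr rfl fun u _ => if_congr ?_ rfl rfl
    rw [Bool.and_true, hlow]
  · rw [← hL.sum_eq, Fintype.card_subtype, card_filter]
    refine sum_congr rfl fun u _ => if_congr ?_ rfl rfl
    rw [Bool.and_true, hup]

end Swap

def perm4 : Equiv.Perm (Fin 4) :=
  ⟨![1, 2, 3, 0], ![3, 0, 1, 2], by decide, by decide⟩

def orbits4 : List (List ℕ) :=
  [[0], [1, 8, 4, 2], [3, 9, 12, 6], [5, 10], [7, 11, 13, 14], [15]]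

def steps4 : List (ℕ × ℕ) :=
  [(1, 1), (278, 279), (4680, 4959), (1056, 1335), (26752, 32767), (32768, 65535)]

theorem lists_steps4 : Lists perm4 (leaves steps4 0) :=
  lists_leaves (l := orbits4) (by decide +kernel) (by decide +kernel) (by decide +kernel)

def masks4 : List ℕ :=
  [65535, 65534, 65256, 64200, 60576, 59520, 32768, 0]

theorem lists_masks4 : Lists perm4 masks4 := by
  have h : leaves steps4 0 = masks4 := by decide +kernel
  exact h ▸ lists_steps4

theorem card_fixThree_perm4 : Fintype.card (FM 7 (fixThree perm4)) = 60312 := by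
  have h : Evaluates (sumMap (cubeSum masks4) masks4) 60312 := by decide +kernel
  exact (card_fixThree lists_masks4 (by decide +kernel)).trans h.eq

def perm31 : Equiv.Perm (Fin 4) :=
  ⟨![1, 2, 0, 3], ![2, 0, 1, 3], by decide, by decide⟩

def orbits31 : List (List ℕ) :=
  [[0], [1, 4, 2], [3, 5, 6], [7], [8], [9, 12, 10], [11, 13, 14], [15]]

def steps31 : List (ℕ × ℕ) :=
  [(1, 1), (22, 23), (104, 127), (128, 255), (256, 257), (5632, 5911), (26624, 32639), (32768,
   65535)]

theorem lists_steps31 : Lists perm31 (leaves steps31 0) :=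
  lists_leaves (l := orbits31) (by decide +kernel) (by decide +kernel) (by decide +kernel)

def masks31 : List ℕ :=
  [65535, 65534, 65278, 65512, 65256, 59624, 65408, 65152, 59520, 32896, 65280, 65024, 59392,
   32768, 0]

theorem lists_masks31 : Lists perm31 masks31 := by
  have h : leaves steps31 0 = masks31 := by decide +kernel
  exact h ▸ lists_steps31

theorem card_fixThree_perm31 : Fintype.card (FM 7 (fixThree perm31)) = 2068224 := by
  have h : Evaluates (sumMap (cubeSum masks31) masks31) 2068224 := by decide +kernel
  exact (card_fixThree lists_masks31 (by decide +kernel)).trans h.eq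

def perm22 : Equiv.Perm (Fin 4) :=
  ⟨![1, 0, 3, 2], ![1, 0, 3, 2], by decide, by decide⟩

def orbits22 : List (List ℕ) :=
  [[0], [1, 2], [3], [4, 8], [5, 10], [6, 9], [7, 11], [12], [13, 14], [15]]

def steps22 : List (ℕ × ℕ) :=
  [(1, 1), (6, 7), (8, 15), (272, 273), (1056, 1335), (576, 855), (2176, 4095), (4096, 4369),
   (24576, 30583), (32768, 65535)]

theorem lists_steps22 : Lists perm22 (leaves steps22 0) :=
  lists_leaves (l := orbits22) (by decide +kernel) (by decide +kernel) (by decide +kernel)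

def masks22 : List ℕ :=
  [65535, 65534, 65262, 61166, 65528, 65256, 61160, 64680, 60584, 64200, 60104, 63624, 59528,
   34952, 65520, 65248, 61152, 64672, 60576, 64192, 60096, 63616, 59520, 34944, 61440, 57344,
   32768, 0]

theorem lists_masks22 : Lists perm22 masks22 := by
  have h : leaves steps22 0 = masks22 := by decide +kernel
  exact h ▸ lists_steps22

theorem card_fixThree_perm22 : Fintype.card (FM 7 (fixThree perm22)) = 67922470 := by
  have h : Evaluates (sumMap (cubeSum masks22) masks22) 67922470 := by decide +kernel
  exact (card_fixThree lists_masks22 (by decide +kernel)).trans h.eq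

def perm211 : Equiv.Perm (Fin 4) :=
  ⟨![1, 0, 2, 3], ![1, 0, 2, 3], by decide, by decide⟩

def orbits211 : List (List ℕ) :=
  [[0], [1, 2], [3], [4], [5, 6], [7], [8], [9, 10], [11], [12], [13, 14], [15]]

def steps211 : List (ℕ × ℕ) :=
  [(1, 1), (6, 7), (8, 15), (16, 17), (96, 119), (128, 255), (256, 257), (1536, 1799), (2048,
   3855), (4096, 4369), (24576, 30583), (32768, 65535)]

theorem lists_steps211 : Lists perm211 (leaves steps211 0) :=
  lists_leaves (l := orbits211) (by decide +kernel) (by decide +kernel) (by decide +kernel)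

def masks211 : List ℕ :=
  [65535, 65534, 65278, 65518, 65262, 61166, 65528, 65272, 63736, 65512, 65256, 61160, 63720,
   59624, 65416, 65160, 61064, 63624, 59528, 34952, 65520, 65264, 63728, 61680, 65504, 65248,
   61152, 63712, 59616, 61664, 57568, 65408, 65152, 61056, 63616, 59520, 34944, 61568, 57472,
   32896, 65280, 65024, 60928, 63488, 59392, 34816, 61440, 57344, 32768, 0]

theorem lists_masks211 : Lists perm211 masks211 := by
  have h : leaves steps211 0 = masks211 := by decide +kernel
  exact h ▸ lists_steps211

theorem card_fixThree_perm211 : Fintype.card (FM 7 (fixThree perm211)) = 2208001624 := by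
  have h : Evaluates (sumMap (cubeSum masks211) masks211) 2208001624 := by decide +kernel
  exact (card_fixThree lists_masks211 (by decide +kernel)).trans h.eq

def orbits1111 : List (List ℕ) :=
  [[0], [1], [2], [3], [4], [5], [6], [7], [8], [9], [10], [11], [12], [13], [14], [15]]

def steps1111 : List (ℕ × ℕ) :=
  [(1, 1), (2, 3), (4, 5), (8, 15), (16, 17), (32, 51), (64, 85), (128, 255), (256, 257), (512,
   771), (1024, 1285), (2048, 3855), (4096, 4369), (8192, 13107), (16384, 21845), (32768, 65535)]

theorem lists_steps1111 : Lists (1 : Equiv.Perm (Fin 4)) (leaves steps1111 0) :=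
  lists_leaves (l := orbits1111) (by decide +kernel) (by decide +kernel) (by decide +kernel)

def masks1111 : List ℕ :=
  [65535, 65534, 65278, 65518, 65262, 61166, 65530, 65274, 64250, 65514, 65258, 61162, 64234,
   60138, 65450, 65194, 61098, 64170, 60074, 43690, 65532, 65276, 64764, 65516, 65260, 61164,
   64748, 60652, 65484, 65228, 61132, 64716, 60620, 52428, 65528, 65272, 64248, 64760, 63736,
   65512, 65256, 61160, 64232, 60136, 64744, 60648, 63720, 59624, 65448, 65192, 61096, 64168,
   60072, 43688, 64680, 60584, 63656, 59560, 43176, 65480, 65224, 61128, 64200, 60104, 64712,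
   60616, 52424, 63688, 59592, 51400, 65416, 65160, 61064, 64136, 60040, 43656, 64648, 60552,
   52360, 63624, 59528, 43144, 51336, 34952, 65520, 65264, 64240, 64752, 63728, 61680, 65504,
   65248, 61152, 64224, 60128, 64736, 60640, 63712, 59616, 61664, 57568, 65440, 65184, 61088,
   64160, 60064, 43680, 64672, 60576, 63648, 59552, 43168, 61600, 57504, 41120, 65472, 65216,
   61120, 64192, 60096, 64704, 60608, 52416, 63680, 59584, 51392, 61632, 57536, 49344, 65408,
   65152, 61056, 64128, 60032, 43648, 64640, 60544, 52352, 63616, 59520, 43136, 51328, 34944,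
   61568, 57472, 41088, 49280, 32896, 65280, 65024, 60928, 64000, 59904, 43520, 64512, 60416,
   52224, 63488, 59392, 43008, 51200, 34816, 61440, 57344, 40960, 49152, 32768, 0]

theorem lists_masks1111 : Lists (1 : Equiv.Perm (Fin 4)) masks1111 := by
  have h : leaves steps1111 0 = masks1111 := by decide +kernel
  exact h ▸ lists_steps1111

theorem cubeSum_0 : Evaluates (cubeSum masks1111 0) 1 := by decide +kernel

theorem cubeSum_32768 : Evaluates (cubeSum masks1111 32768) 19 := by decide +kernel

theorem cubeSum_32896 : Evaluates (cubeSum masks1111 32896) 148 := by decide +kernel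

theorem cubeSum_34944 : Evaluates (cubeSum masks1111 34944) 1692 := by decide +kernel

theorem cubeSum_34952 : Evaluates (cubeSum masks1111 34952) 5573 := by decide +kernel

theorem cubeSum_43136 : Evaluates (cubeSum masks1111 43136) 23386 := by decide +kernel

theorem cubeSum_43144 : Evaluates (cubeSum masks1111 43144) 83963 := by decide +kernel

theorem cubeSum_43176 : Evaluates (cubeSum masks1111 43176) 387651 := by decide +kernel

theorem cubeSum_43688 : Evaluates (cubeSum masks1111 43688) 2453690 := by decide +kernel

theorem cubeSum_43690 : Evaluates (cubeSum masks1111 43690) 3914177 := by decide +kernel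

theorem cubeSum_59520 : Evaluates (cubeSum masks1111 59520) 357768 := by decide +kernel

theorem cubeSum_59528 : Evaluates (cubeSum masks1111 59528) 1359219 := by decide +kernel

theorem cubeSum_59560 : Evaluates (cubeSum masks1111 59560) 6560991 := by decide +kernel

theorem cubeSum_59624 : Evaluates (cubeSum masks1111 59624) 36628823 := by decide +kernel

theorem cubeSum_60072 : Evaluates (cubeSum masks1111 60072) 42890750 := by decide +kernel

theorem cubeSum_60074 : Evaluates (cubeSum masks1111 60074) 69128537 := by decide +kernel

theorem cubeSum_60096 : Evaluates (cubeSum masks1111 60096) 5359485 := by decide +kernel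

theorem cubeSum_60104 : Evaluates (cubeSum masks1111 60104) 33324898 := by decide +kernel

theorem cubeSum_60136 : Evaluates (cubeSum masks1111 60136) 250765907 := by decide +kernel

theorem cubeSum_60138 : Evaluates (cubeSum masks1111 60138) 418462781 := by decide +kernel

theorem cubeSum_61152 : Evaluates (cubeSum masks1111 61152) 223027065 := by decide +kernel

theorem cubeSum_61160 : Evaluates (cubeSum masks1111 61160) 1985469292 := by decide +kernel

theorem cubeSum_61162 : Evaluates (cubeSum masks1111 61162) 3459634313 := by decide +kernel

theorem cubeSum_61166 : Evaluates (cubeSum masks1111 61166) 6659474173 := by decide +kernel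

theorem cubeSum_65256 : Evaluates (cubeSum masks1111 65256) 18461926643 := by decide +kernel

theorem cubeSum_65258 : Evaluates (cubeSum masks1111 65258) 33752388476 := by decide +kernel

theorem cubeSum_65262 : Evaluates (cubeSum masks1111 65262) 69120323164 := by decide +kernel

theorem cubeSum_65278 : Evaluates (cubeSum masks1111 65278) 166742156572 := by decide +kernel

theorem cubeSum_65534 : Evaluates (cubeSum masks1111 65534) 510955171111 := by decide +kernel

theorem cubeSum_65535 : Evaluates (cubeSum masks1111 65535) 565350642844 := by decide +kernel

/-- The renamings of four variables. -/
def decodePerm (i : ℕ) : Equiv.Perm (Fin 4) :=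
  perm4 ^ (i % 4) * perm31 ^ (i / 4 % 3) * perm211 ^ (i / 12)

/-- The representatives, the values of `cubeSum` there, and the renamings which produce their
orbits. -/
def classes1111 : List (ℕ × ℕ × List ℕ) :=
  [(0, 1, [0]), (32768, 19, [0]), (32896, 148, [0, 1, 2, 3]), (34944, 1692, [0, 1, 2, 3, 8, 9]),
   (34952, 5573, [0, 1, 2, 3, 8, 9]), (43136, 23386, [0, 1, 2, 3]), (43144, 83963, [0, 1, 2, 3, 8,
   9, 10, 11, 12, 13, 14, 15]), (43176, 387651, [0, 1, 2, 3, 4, 5, 6, 7, 8, 9, 10, 11]), (43688,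
   2453690, [0, 1, 2, 3]), (43690, 3914177, [0, 1, 2, 3]), (59520, 357768, [0]), (59528, 1359219,
   [0, 1, 2, 3, 8, 9]), (59560, 6560991, [0, 1, 2, 3, 4, 5, 6, 7, 8, 9, 10, 11]), (59624,
   36628823, [0, 1, 2, 3]), (60072, 42890750, [0, 1, 2, 3]), (60074, 69128537, [0, 1, 2, 3]),
   (60096, 5359485, [0, 1, 4]), (60104, 33324898, [0, 1, 2, 3, 4, 5, 6, 7, 8, 9, 20, 21]), (60136,
   250765907, [0, 1, 2, 3, 4, 5, 6, 7, 8, 9, 10, 11]), (60138, 418462781, [0, 1, 2, 3, 4, 5, 6, 7,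
   8, 9, 10, 11]), (61152, 223027065, [0, 1, 8]), (61160, 1985469292, [0, 1, 2, 3, 8, 9]), (61162,
   3459634313, [0, 1, 2, 3, 8, 9, 10, 11, 12, 13, 14, 15]), (61166, 6659474173, [0, 1, 2, 3, 8,
   9]), (65256, 18461926643, [0]), (65258, 33752388476, [0, 1, 2, 3]), (65262, 69120323164, [0, 1,
   2, 3, 8, 9]), (65278, 166742156572, [0, 1, 2, 3]), (65534, 510955171111, [0]), (65535,
   565350642844, [0])]

theorem cubeSum_classes1111 : ∀ q ∈ classes1111, Evaluates (cubeSum masks1111 q.1) q.2.1 := by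
  simp only [classes1111, List.forall_mem_cons, List.not_mem_nil, false_implies, implies_true,
    and_true]
  exact ⟨cubeSum_0, cubeSum_32768, cubeSum_32896, cubeSum_34944, cubeSum_34952, cubeSum_43136,
   cubeSum_43144, cubeSum_43176, cubeSum_43688, cubeSum_43690, cubeSum_59520, cubeSum_59528,
   cubeSum_59560, cubeSum_59624, cubeSum_60072, cubeSum_60074, cubeSum_60096, cubeSum_60104,
   cubeSum_60136, cubeSum_60138, cubeSum_61152, cubeSum_61160, cubeSum_61162, cubeSum_61166,
   cubeSum_65256, cubeSum_65258, cubeSum_65262, cubeSum_65278, cubeSum_65534, cubeSum_65535⟩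

theorem card_fixThree_one :
    Fintype.card (FM 7 (fixThree (1 : Equiv.Perm (Fin 4)))) = 2414682040998 := by
  rw [card_fixThree lists_masks1111 (by decide +kernel), sum_cubeSum_eq lists_masks1111
    (by decide +kernel) decodePerm classes1111 cubeSum_classes1111 (by decide +kernel)
    (by decide +kernel)]
  decide +kernel

def perm221 : Equiv.Perm (Fin 5) :=
  ⟨![1, 0, 3, 2, 4], ![1, 0, 3, 2, 4], by decide, by decide⟩

def orbits221 : List (List ℕ) :=
  [[0], [1, 2], [3], [4, 8], [5, 10], [6, 9], [7, 11], [12], [13, 14], [15], [16], [17, 18], [19],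
   [20, 24], [21, 26], [22, 25], [23, 27], [28], [29, 30], [31]]

def steps221 : List (ℕ × ℕ) :=
  [(1, 1), (6, 7), (8, 15), (272, 273), (1056, 1335), (576, 855), (2176, 4095), (4096, 4369),
   (24576, 30583), (32768, 65535), (65536, 65537), (393216, 458759), (524288, 983055), (17825792,
   17891601), (69206016, 87491895), (37748736, 56034135), (142606336, 268374015), (268435456,
   286331153), (1610612736, 2004318071), (2147483648, 4294967295)]

theorem lists_steps221 : Lists perm221 (leaves steps221 0) :=
  lists_leaves (l := orbits221) (by decide +kernel) (by decide +kernel) (by decide +kernel)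

def masks221 : List ℕ :=
  [4294967295, 4294967294, 4294901758, 4294967022, 4294901486, 4277075694, 4294962926, 4294897390,
   4277071598, 4008636142, 4294967288, 4294901752, 4294508536, 4294967016, 4294901480, 4277075688,
   4294508264, 4276682472, 4294962920, 4294897384, 4277071592, 4008636136, 4294504168, 4276678376,
   4008242920, 4294966440, 4294900904, 4277075112, 4294507688, 4276681896, 4238933160, 4294962344,
   4294896808, 4277071016, 4008635560, 4294503592, 4276677800, 4008242344, 4238929064, 3970493608,
   4294965960, 4294900424, 4277074632, 4294507208, 4276681416, 4207475400, 4294961864, 4294896328,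
   4277070536, 4008635080, 4294503112, 4276677320, 4008241864, 4207471304, 3939035848, 4294965384,
   4294899848, 4277074056, 4294506632, 4276680840, 4238932104, 4207474824, 4169726088, 4294961288,
   4294895752, 4277069960, 4008634504, 4294502536, 4276676744, 4008241288, 4238928008, 3970492552,
   4207470728, 3939035272, 4169721992, 3901286536, 4294936712, 4294871176, 4277045384, 4008609928,
   4294477960, 4276652168, 4008216712, 4238903432, 3970467976, 4207446152, 3939010696, 4169697416,
   3901261960, 2290649224, 4294967280, 4294901744, 4294508528, 4293984240, 4294967008, 4294901472,
   4277075680, 4294508256, 4276682464, 4293983968, 4276158176, 4294962912, 4294897376, 4277071584,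
   4008636128, 4294504160, 4276678368, 4008242912, 4293979872, 4276154080, 4007718624, 4294966432,
   4294900896, 4277075104, 4294507680, 4276681888, 4238933152, 4293983392, 4276157600, 4238408864,
   4294962336, 4294896800, 4277071008, 4008635552, 4294503584, 4276677792, 4008242336, 4238929056,
   3970493600, 4293979296, 4276153504, 4007718048, 4238404768, 3969969312, 4294965952, 4294900416,
   4277074624, 4294507200, 4276681408, 4207475392, 4293982912, 4276157120, 4206951104, 4294961856,
   4294896320, 4277070528, 4008635072, 4294503104, 4276677312, 4008241856, 4207471296, 3939035840,
   4293978816, 4276153024, 4007717568, 4206947008, 3938511552, 4294965376, 4294899840, 4277074048,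
   4294506624, 4276680832, 4238932096, 4207474816, 4169726080, 4293982336, 4276156544, 4238407808,
   4206950528, 4169201792, 4294961280, 4294895744, 4277069952, 4008634496, 4294502528, 4276676736,
   4008241280, 4238928000, 3970492544, 4207470720, 3939035264, 4169721984, 3901286528, 4293978240,
   4276152448, 4007716992, 4238403712, 3969968256, 4206946432, 3938510976, 4169197696, 3900762240,
   4294936704, 4294871168, 4277045376, 4008609920, 4294477952, 4276652160, 4008216704, 4238903424,
   3970467968, 4207446144, 3939010688, 4169697408, 3901261952, 2290649216, 4293953664, 4276127872,
   4007692416, 4238379136, 3969943680, 4206921856, 3938486400, 4169173120, 3900737664, 2290124928,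
   4294963200, 4294897664, 4277071872, 4294504448, 4276678656, 4238929920, 4207472640, 4169723904,
   4293980160, 4276154368, 4238405632, 4206948352, 4169199616, 4026593280, 4294959104, 4294893568,
   4277067776, 4008632320, 4294500352, 4276674560, 4008239104, 4238925824, 3970490368, 4207468544,
   3939033088, 4169719808, 3901284352, 4293976064, 4276150272, 4007714816, 4238401536, 3969966080,
   4206944256, 3938508800, 4169195520, 3900760064, 4026589184, 3758153728, 4294934528, 4294868992,
   4277043200, 4008607744, 4294475776, 4276649984, 4008214528, 4238901248, 3970465792, 4207443968,
   3939008512, 4169695232, 3901259776, 2290647040, 4293951488, 4276125696, 4007690240, 4238376960,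
   3969941504, 4206919680, 3938484224, 4169170944, 3900735488, 2290122752, 4026564608, 3758129152,
   2147516416, 4294901760, 4294836224, 4277010432, 4008574976, 4294443008, 4276617216, 4008181760,
   4238868480, 3970433024, 4207411200, 3938975744, 4169662464, 3901227008, 2290614272, 4293918720,
   4276092928, 4007657472, 4238344192, 3969908736, 4206886912, 3938451456, 4169138176, 3900702720,
   2290089984, 4026531840, 3758096384, 2147483648, 0]

theorem lists_masks221 : Lists perm221 masks221 := by
  have h : leaves steps221 0 = masks221 := by decide +kernel
  exact h ▸ lists_steps221

def orbits221Sq : List (List ℕ) :=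
  [[0], [1], [2], [3], [4], [5], [6], [7], [8], [9], [10], [11], [12], [13], [14], [15], [16],
   [17], [18], [19], [20], [21], [22], [23], [24], [25], [26], [27], [28], [29], [30], [31]]

def steps221Sq : List (ℕ × ℕ) :=
  [(1, 1), (2, 3), (4, 5), (8, 15), (16, 17), (32, 51), (64, 85), (128, 255), (256, 257), (512,
   771), (1024, 1285), (2048, 3855), (4096, 4369), (8192, 13107), (16384, 21845), (32768, 65535),
   (65536, 65537), (131072, 196611), (262144, 327685), (524288, 983055), (1048576, 1114129),
   (2097152, 3342387), (4194304, 5570645), (8388608, 16711935), (16777216, 16843009), (33554432,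
   50529027), (67108864, 84215045), (134217728, 252645135), (268435456, 286331153), (536870912,
   858993459), (1073741824, 1431655765), (2147483648, 4294967295)]

def perm2221 : Equiv.Perm (Fin 7) :=
  ⟨![1, 0, 3, 2, 5, 4, 6], ![1, 0, 3, 2, 5, 4, 6], by decide, by decide⟩

theorem card_perm2221 : Fintype.card (FM 7 perm2221) = 12015832 := by
  have h : Evaluates (sumPairs masks221 steps221Sq 0 (pack (fun _ => 1) masks221)
      (pack (fun _ => 1) masks221)) 12015832 := by decide +kernel
  exact (card_of_swap rfl rfl (by decide) lists_masks221 (by decide +kernel) (l := orbits221Sq)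
    (by decide +kernel) (by decide +kernel) (by decide +kernel)).trans h.eq

def perm311 : Equiv.Perm (Fin 5) :=
  ⟨![1, 2, 0, 3, 4], ![2, 0, 1, 3, 4], by decide, by decide⟩

def orbits311 : List (List ℕ) :=
  [[0], [1, 4, 2], [3, 5, 6], [7], [8], [9, 12, 10], [11, 13, 14], [15], [16], [17, 20, 18], [19,
   21, 22], [23], [24], [25, 28, 26], [27, 29, 30], [31]]

def steps311 : List (ℕ × ℕ) :=
  [(1, 1), (22, 23), (104, 127), (128, 255), (256, 257), (5632, 5911), (26624, 32639), (32768,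
   65535), (65536, 65537), (1441792, 1507351), (6815744, 8323199), (8388608, 16711935), (16777216,
   16843009), (369098752, 387389207), (1744830464, 2139062143), (2147483648, 4294967295)]

theorem lists_steps311 : Lists perm311 (leaves steps311 0) :=
  lists_leaves (l := orbits311) (by decide +kernel) (by decide +kernel) (by decide +kernel)

def masks311 : List ℕ :=
  [4294967295, 4294967294, 4294901758, 4294967038, 4294901502, 4278124286, 4294967272, 4294901736,
   4293459944, 4294967016, 4294901480, 4278124264, 4293459688, 4276682472, 4294961384, 4294895848,
   4278118632, 4293454056, 4276676840, 3907578088, 4294967168, 4294901632, 4293459840, 4286644096,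
   4294966912, 4294901376, 4278124160, 4293459584, 4276682368, 4286643840, 4269866624, 4294961280,
   4294895744, 4278118528, 4293453952, 4276676736, 3907577984, 4286638208, 4269860992, 3900762240,
   4294934656, 4294869120, 4278091904, 4293427328, 4276650112, 3907551360, 4286611584, 4269834368,
   3900735616, 2155905152, 4294967040, 4294901504, 4293459712, 4286643968, 4278255360, 4294966784,
   4294901248, 4278124032, 4293459456, 4276682240, 4286643712, 4269866496, 4278255104, 4261477888,
   4294961152, 4294895616, 4278118400, 4293453824, 4276676608, 3907577856, 4286638080, 4269860864,
   3900762112, 4278249472, 4261472256, 3892373504, 4294934528, 4294868992, 4278091776, 4293427200,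
   4276649984, 3907551232, 4286611456, 4269834240, 3900735488, 2155905024, 4278222848, 4261445632,
   3892346880, 2147516416, 4294901760, 4294836224, 4278059008, 4293394432, 4276617216, 3907518464,
   4286578688, 4269801472, 3900702720, 2155872256, 4278190080, 4261412864, 3892314112, 2147483648,
   0]

theorem lists_masks311 : Lists perm311 masks311 := by
  have h : leaves steps311 0 = masks311 := by decide +kernel
  exact h ▸ lists_steps311

def orbits311Sq : List (List ℕ) :=
  [[0], [1, 2, 4], [3, 6, 5], [7], [8], [9, 10, 12], [11, 14, 13], [15], [16], [17, 18, 20], [19,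
   22, 21], [23], [24], [25, 26, 28], [27, 30, 29], [31]]

def steps311Sq : List (ℕ × ℕ) :=
  [(1, 1), (22, 23), (104, 127), (128, 255), (256, 257), (5632, 5911), (26624, 32639), (32768,
   65535), (65536, 65537), (1441792, 1507351), (6815744, 8323199), (8388608, 16711935), (16777216,
   16843009), (369098752, 387389207), (1744830464, 2139062143), (2147483648, 4294967295)]

def perm2311 : Equiv.Perm (Fin 7) :=
  ⟨![1, 0, 3, 4, 2, 5, 6], ![1, 0, 4, 2, 3, 5, 6], by decide, by decide⟩

theorem card_perm2311 : Fintype.card (FM 7 perm2311) = 59542 := by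
  have h : Evaluates (sumPairs masks311 steps311Sq 0 (pack (fun _ => 1) masks311)
      (pack (fun _ => 1) masks311)) 59542 := by decide +kernel
  exact (card_of_swap rfl rfl (by decide) lists_masks311 (by decide +kernel) (l := orbits311Sq)
    (by decide +kernel) (by decide +kernel) (by decide +kernel)).trans h.eq

def perm41 : Equiv.Perm (Fin 5) :=
  ⟨![1, 2, 3, 0, 4], ![3, 0, 1, 2, 4], by decide, by decide⟩

def orbits41 : List (List ℕ) :=
  [[0], [1, 8, 4, 2], [3, 9, 12, 6], [5, 10], [7, 11, 13, 14], [15], [16], [17, 24, 20, 18], [19,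
   25, 28, 22], [21, 26], [23, 27, 29, 30], [31]]

def steps41 : List (ℕ × ℕ) :=
  [(1, 1), (278, 279), (4680, 4959), (1056, 1335), (26752, 32767), (32768, 65535), (65536, 65537),
   (18219008, 18284823), (306708480, 324997983), (69206016, 87491895), (1753219072, 2147450879),
   (2147483648, 4294967295)]

theorem lists_steps41 : Lists perm41 (leaves steps41 0) :=
  lists_leaves (l := orbits41) (by decide +kernel) (by decide +kernel) (by decide +kernel)

def masks41 : List ℕ :=
  [4294967295, 4294967294, 4294901758, 4294967016, 4294901480, 4276682472, 4294965960, 4294900424,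
   4276681416, 4207475400, 4294962336, 4294896800, 4276677792, 3969969312, 4294961280, 4294895744,
   4276676736, 4207470720, 3969968256, 3900762240, 4294934528, 4294868992, 4276649984, 4207443968,
   3969941504, 3900735488, 2147516416, 4294901760, 4294836224, 4276617216, 4207411200, 3969908736,
   3900702720, 2147483648, 0]

theorem lists_masks41 : Lists perm41 masks41 := by
  have h : leaves steps41 0 = masks41 := by decide +kernel
  exact h ▸ lists_steps41

def orbits41Sq : List (List ℕ) :=
  [[0], [1, 4], [2, 8], [3, 12], [5], [6, 9], [7, 13], [10], [11, 14], [15], [16], [17, 20], [18,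
   24], [19, 28], [21], [22, 25], [23, 29], [26], [27, 30], [31]]

def steps41Sq : List (ℕ × ℕ) :=
  [(1, 1), (18, 19), (260, 261), (4104, 4383), (32, 51), (576, 855), (8320, 13311), (1024, 1285),
   (18432, 24415), (32768, 65535), (65536, 65537), (1179648, 1245203), (17039360, 17105157),
   (268959744, 287248671), (2097152, 3342387), (37748736, 56034135), (545259520, 872363007),
   (67108864, 84215045), (1207959552, 1600085855), (2147483648, 4294967295)]

def perm241 : Equiv.Perm (Fin 7) :=
  ⟨![1, 0, 3, 4, 5, 2, 6], ![1, 0, 5, 2, 3, 4, 6], by decide, by decide⟩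

theorem card_perm241 : Fintype.card (FM 7 perm241) = 26878 := by
  have h : Evaluates (sumPairs masks41 steps41Sq 0 (pack (fun _ => 1) masks41)
      (pack (fun _ => 1) masks41)) 26878 := by decide +kernel
  exact (card_of_swap rfl rfl (by decide) lists_masks41 (by decide +kernel) (l := orbits41Sq)
    (by decide +kernel) (by decide +kernel) (by decide +kernel)).trans h.eq

def perm32 : Equiv.Perm (Fin 5) :=
  ⟨![1, 2, 0, 4, 3], ![2, 0, 1, 4, 3], by decide, by decide⟩

def orbits32 : List (List ℕ) :=
  [[0], [1, 4, 2], [3, 5, 6], [7], [8, 16], [9, 20, 10, 17, 12, 18], [11, 21, 14, 19, 13, 22],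
   [15, 23], [24], [25, 28, 26], [27, 29, 30], [31]]

def steps32 : List (ℕ × ℕ) :=
  [(1, 1), (22, 23), (104, 127), (128, 255), (65792, 65793), (1447424, 1513239), (6842368,
   8355711), (8421376, 16777215), (16777216, 16843009), (369098752, 387389207), (1744830464,
   2139062143), (2147483648, 4294967295)]

theorem lists_steps32 : Lists perm32 (leaves steps32 0) :=
  lists_leaves (l := orbits32) (by decide +kernel) (by decide +kernel) (by decide +kernel)

def masks32 : List ℕ :=
  [4294967295, 4294967294, 4294901502, 4278124286, 4294967272, 4294901480, 4278124264, 4293454056,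
   4276676840, 3907578088, 4294967168, 4294901376, 4278124160, 4293453952, 4276676736, 3907577984,
   4286611584, 4269834368, 3900735616, 2155905152, 4294967040, 4294901248, 4278124032, 4293453824,
   4276676608, 3907577856, 4286611456, 4269834240, 3900735488, 2155905024, 4278190080, 4261412864,
   3892314112, 2147483648, 0]

theorem lists_masks32 : Lists perm32 masks32 := by
  have h : leaves steps32 0 = masks32 := by decide +kernel
  exact h ▸ lists_steps32

def orbits32Sq : List (List ℕ) :=
  [[0], [1, 2, 4], [3, 6, 5], [7], [8], [9, 10, 12], [11, 14, 13], [15], [16], [17, 18, 20], [19,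
   22, 21], [23], [24], [25, 26, 28], [27, 30, 29], [31]]

def steps32Sq : List (ℕ × ℕ) :=
  [(1, 1), (22, 23), (104, 127), (128, 255), (256, 257), (5632, 5911), (26624, 32639), (32768,
   65535), (65536, 65537), (1441792, 1507351), (6815744, 8323199), (8388608, 16711935), (16777216,
   16843009), (369098752, 387389207), (1744830464, 2139062143), (2147483648, 4294967295)]

def perm232 : Equiv.Perm (Fin 7) :=
  ⟨![1, 0, 3, 4, 2, 6, 5], ![1, 0, 4, 2, 3, 6, 5], by decide, by decide⟩

theorem card_perm232 : Fintype.card (FM 7 perm232) = 10192 := by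
  have h : Evaluates (sumPairs masks32 steps32Sq 0 (pack (fun _ => 1) masks32)
      (pack (fun _ => 1) masks32)) 10192 := by decide +kernel
  exact (card_of_swap rfl rfl (by decide) lists_masks32 (by decide +kernel) (l := orbits32Sq)
    (by decide +kernel) (by decide +kernel) (by decide +kernel)).trans h.eq

def perm5 : Equiv.Perm (Fin 5) :=
  ⟨![1, 2, 3, 4, 0], ![4, 0, 1, 2, 3], by decide, by decide⟩

def orbits5 : List (List ℕ) :=
  [[0], [1, 16, 8, 4, 2], [3, 17, 24, 12, 6], [5, 18, 9, 20, 10], [7, 19, 25, 28, 14], [11, 21,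
   26, 13, 22], [15, 23, 27, 29, 30], [31]]

def steps5 : List (ℕ × ℕ) :=
  [(1, 1), (65814, 65815), (16912456, 16978271), (1312288, 1378103), (302530688, 320821247),
   (73410560, 91701119), (1753251840, 2147483647), (2147483648, 4294967295)]

theorem lists_steps5 : Lists perm5 (leaves steps5 0) :=
  lists_leaves (l := orbits5) (by decide +kernel) (by decide +kernel) (by decide +kernel)

def masks5 : List ℕ :=
  [4294967295, 4294967294, 4294901480, 4293589192, 4277989024, 4276676736, 4203266176, 3974146048,
   3900735488, 2147483648, 0]

theorem lists_masks5 : Lists perm5 masks5 := by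
  have h : leaves steps5 0 = masks5 := by decide +kernel
  exact h ▸ lists_steps5

def orbits5Sq : List (List ℕ) :=
  [[0], [1, 8, 2, 16, 4], [3, 24, 6, 17, 12], [5, 9, 10, 18, 20], [7, 25, 14, 19, 28], [11, 26,
   22, 21, 13], [15, 27, 30, 23, 29], [31]]

def steps5Sq : List (ℕ × ℕ) :=
  [(1, 1), (65814, 65815), (16912456, 16978271), (1312288, 1378103), (302530688, 320821247),
   (73410560, 91701119), (1753251840, 2147483647), (2147483648, 4294967295)]

def perm25 : Equiv.Perm (Fin 7) :=
  ⟨![1, 0, 3, 4, 5, 6, 2], ![1, 0, 6, 2, 3, 4, 5], by decide, by decide⟩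

theorem card_perm25 : Fintype.card (FM 7 perm25) = 264 := by
  have h : Evaluates (sumPairs masks5 steps5Sq 0 (pack (fun _ => 1) masks5)
      (pack (fun _ => 1) masks5)) 264 := by decide +kernel
  exact (card_of_swap rfl rfl (by decide) lists_masks5 (by decide +kernel) (l := orbits5Sq)
    (by decide +kernel) (by decide +kernel) (by decide +kernel)).trans h.eq

def perm7 : Equiv.Perm (Fin 7) :=
  ⟨![1, 2, 3, 4, 5, 6, 0], ![6, 0, 1, 2, 3, 4, 5], by decide, by decide⟩

def orbits7 : List (List ℕ) :=
  [[0], [1, 64, 32, 16, 8, 4, 2], [3, 65, 96, 48, 24, 12, 6], [5, 66, 33, 80, 40, 20, 10], [7, 67,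
   97, 112, 56, 28, 14], [9, 68, 34, 17, 72, 36, 18], [11, 69, 98, 49, 88, 44, 22], [13, 70, 35,
   81, 104, 52, 26], [15, 71, 99, 113, 120, 60, 30], [19, 73, 100, 50, 25, 76, 38], [21, 74, 37,
   82, 41, 84, 42], [23, 75, 101, 114, 57, 92, 46], [27, 77, 102, 51, 89, 108, 54], [29, 78, 39,
   83, 105, 116, 58], [31, 79, 103, 115, 121, 124, 62], [43, 85, 106, 53, 90, 45, 86], [47, 87,
   107, 117, 122, 61, 94], [55, 91, 109, 118, 59, 93, 110], [63, 95, 111, 119, 123, 125, 126],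
   [127]]

def steps7 : List (ℕ × ℕ) :=
  [(1, 1), (18446744078004584726, 18446744078004584727), (79228162551158107215956545608,
   79228162569604851293961130335), (1208999606592032115524640, 1209018053336110120109367),
   (5192455314860003803215867399913600, 5192534544231573014659193476568575),
   (5017514388134897779200, 5035961132212902363927), (317222135657175086343749896192,
   396451512243900917804724330367), (20282412022683905777557066227712,
   20361641399270631609018040661887), (1339613223327288004611731741793615872,
   1344826357505682936221642970984087551), (1267650685230827219325135880192,
   1346878852817946458753994789727), (24197405858230796585795584, 25411441425955041603684151),
   (20771727687137703190494592309919744, 25965847128392587580078386155839487),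
   (329589775180475034797307387183104, 351536289400633668711994313621375),
   (83117314565738183697387452905816064, 88331399196880094817662460068067327),
   (23967652440202170626653476364467830784, 25416698697410792561483248809776513023),
   (81130992411524659131644395913216, 101809880143858324057802772266879),
   (5483227761851390324874336381117136896, 6932025560277243309328443163434549247),
   (334254122647579922052942999507173376, 443768287521325376930115347418152959),
   (138906921747567057398617643881087369216, 170141183460469231731687303715884105727),
   (170141183460469231731687303715884105728, 340282366920938463463374607431768211455)]

theorem card_perm7 : Fintype.card (FM 7 perm7) = 101 := by
  have h : Evaluates (sumLeaves (fun _ => 1) steps7 0) 101 := by decide +kernel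
  exact (card_eq_sumLeaves (l := orbits7) (by decide +kernel) (by decide +kernel)
    (by decide +kernel)).trans h.eq

def perm61 : Equiv.Perm (Fin 7) :=
  ⟨![1, 2, 3, 4, 5, 0, 6], ![5, 0, 1, 2, 3, 4, 6], by decide, by decide⟩

def orbits61 : List (List ℕ) :=
  [[0], [1, 32, 16, 8, 4, 2], [3, 33, 48, 24, 12, 6], [5, 34, 17, 40, 20, 10], [7, 35, 49, 56, 28,
   14], [9, 36, 18], [11, 37, 50, 25, 44, 22], [13, 38, 19, 41, 52, 26], [15, 39, 51, 57, 60, 30],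
   [21, 42], [23, 43, 53, 58, 29, 46], [27, 45, 54], [31, 47, 55, 59, 61, 62], [63], [64], [65,
   96, 80, 72, 68, 66], [67, 97, 112, 88, 76, 70], [69, 98, 81, 104, 84, 74], [71, 99, 113, 120,
   92, 78], [73, 100, 82], [75, 101, 114, 89, 108, 86], [77, 102, 83, 105, 116, 90], [79, 103,
   115, 121, 124, 94], [85, 106], [87, 107, 117, 122, 93, 110], [91, 109, 118], [95, 111, 119,
   123, 125, 126], [127]]

def steps61 : List (ℕ × ℕ) :=
  [(1, 1), (4295033110, 4295033111), (281483583426632, 281487878459743), (1116692677664,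
   1120987710775), (72620578619539584, 72903183190676991), (68719739392, 73014772503),
   (1143629569591296, 1426302860468095), (4506073596174336, 4788746887051135),
   (1299289043325976576, 1377841998402158591), (4398048608256, 5519036319031),
   (297316740788912128, 375874093913702399), (18049583015788544, 23981959472430975),
   (7530159316599308288, 9223372036854775807), (9223372036854775808, 18446744073709551615),
   (18446744073709551616, 18446744073709551617), (79229376568278804713974005760,
   79229376586725548791978590487), (5192455624421752007849973553037312,
   5192534853798338733680249115054431), (20599344033853242579483858305024,
   20678573410439968129392529573175), (1339613228279350392055234993003167744,
   1344826362477182584104116421288744447), (1267655445376240825752692457472,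
   1346884821962966374613390787351), (21096241985377244729597496536334336,
   26310643838654812947827797184159615), (83122386405928019884690959526526976,
   88336788259205588106283704200935295), (23967652460009211250607874742278946816,
   25416698718533144476872044187534491647), (81129677100232909363922595741696,
   101808250510672877497713173923127), (5484525826162503715192443059304398848,
   6933653214363537173364008522667229183), (332956038529425900250278626909487104,
   442389068774008733105353040232136575), (138906921747567057389394271844232593408,
   170141183460469231722463931679029329919), (170141183460469231731687303715884105728,
   340282366920938463463374607431768211455)]

theorem card_perm61 : Fintype.card (FM 7 perm61) = 766 := by
  have h : Evaluates (sumLeaves (fun _ => 1) steps61 0) 766 := by decide +kernel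
  exact (card_eq_sumLeaves (l := orbits61) (by decide +kernel) (by decide +kernel)
    (by decide +kernel)).trans h.eq

def perm511 : Equiv.Perm (Fin 7) :=
  ⟨![1, 2, 3, 4, 0, 5, 6], ![4, 0, 1, 2, 3, 5, 6], by decide, by decide⟩

def orbits511 : List (List ℕ) :=
  [[0], [1, 16, 8, 4, 2], [3, 17, 24, 12, 6], [5, 18, 9, 20, 10], [7, 19, 25, 28, 14], [11, 21,
   26, 13, 22], [15, 23, 27, 29, 30], [31], [32], [33, 48, 40, 36, 34], [35, 49, 56, 44, 38], [37,
   50, 41, 52, 42], [39, 51, 57, 60, 46], [43, 53, 58, 45, 54], [47, 55, 59, 61, 62], [63], [64],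
   [65, 80, 72, 68, 66], [67, 81, 88, 76, 70], [69, 82, 73, 84, 74], [71, 83, 89, 92, 78], [75,
   85, 90, 77, 86], [79, 87, 91, 93, 94], [95], [96], [97, 112, 104, 100, 98], [99, 113, 120, 108,
   102], [101, 114, 105, 116, 106], [103, 115, 121, 124, 110], [107, 117, 122, 109, 118], [111,
   119, 123, 125, 126], [127]]

def steps511 : List (ℕ × ℕ) :=
  [(1, 1), (65814, 65815), (16912456, 16978271), (1312288, 1378103), (302530688, 320821247),
   (73410560, 91701119), (1753251840, 2147483647), (2147483648, 4294967295), (4294967296,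
   4294967297), (282668977618944, 282673272652055), (72638445415038976, 72921118704603487),
   (5636234042933248, 5918907316897591), (1299359410996379648, 1377916764047759359),
   (315295954381045760, 393853307203305343), (7530159314451824640, 9223372034707292159),
   (9223372036854775808, 18446744073709551615), (18446744073709551616, 18446744073709551617),
   (1214054014467120430055424, 1214072461211194139672855), (311979747489873548485328896,
   313193819951084742641914207), (24207440887000160071057408, 25421513348211354212042551),
   (5580706175979273362559991808, 5918107436817358265576806399), (1354185812627699461479464960,
   1691587073465784364267159423), (32341787989240366996326973440, 39614081238685424725209907199),
   (39614081257132168796771975168, 79228162495817593524129366015), (79228162514264337593543950336,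
   79228162532711081671548469249), (5214322287713793114381501547413504,
   5214401517090379840212962503622935), (1339942812483344981919957944123785216,
   1345157214312415109322682900544688479), (103970166929518919051956603498528768,
   109184568470816739784805960117454647), (23968950514416199866039115653387911168,
   25418077901263047512585024325405333503), (5816183777943153010771113778777948160,
   7265311160563480292981385092870389631), (138906921707952976132262103047460618240,
   170141183420855150465331762880109871103), (170141183460469231731687303715884105728,
   340282366920938463463374607431768211455)]

theorem card_perm511 : Fintype.card (FM 7 perm511) = 1548 := by
  have h : Evaluates (sumLeaves (fun _ => 1) steps511 0) 1548 := by decide +kernel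
  exact (card_eq_sumLeaves (l := orbits511) (by decide +kernel) (by decide +kernel)
    (by decide +kernel)).trans h.eq

def perm43 : Equiv.Perm (Fin 7) :=
  ⟨![1, 2, 3, 0, 5, 6, 4], ![3, 0, 1, 2, 6, 4, 5], by decide, by decide⟩

def orbits43 : List (List ℕ) :=
  [[0], [1, 8, 4, 2], [3, 9, 12, 6], [5, 10], [7, 11, 13, 14], [15], [16, 64, 32], [17, 72, 36,
   18, 65, 40, 20, 66, 33, 24, 68, 34], [19, 73, 44, 22, 67, 41, 28, 70, 35, 25, 76, 38], [21, 74,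
   37, 26, 69, 42], [23, 75, 45, 30, 71, 43, 29, 78, 39, 27, 77, 46], [31, 79, 47], [48, 80, 96],
   [49, 88, 100, 50, 81, 104, 52, 82, 97, 56, 84, 98], [51, 89, 108, 54, 83, 105, 60, 86, 99, 57,
   92, 102], [53, 90, 101, 58, 85, 106], [55, 91, 109, 62, 87, 107, 61, 94, 103, 59, 93, 110],
   [63, 95, 111], [112], [113, 120, 116, 114], [115, 121, 124, 118], [117, 122], [119, 123, 125,
   126], [127]]

def steps43 : List (ℕ × ℕ) :=
  [(1, 1), (278, 279), (4680, 4959), (1056, 1335), (26752, 32767), (32768, 65535),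
   (18446744078004584448, 18446744078004584449), (5128194853685274476544, 5146641597763279061271),
   (86330762285061455216640, 91477403882824734282591), (19479761746372841177088,
   24626403344136120239415), (493487297574778643152896, 604444463203976218640383),
   (604462909948054223192064, 1208907373152030441865215), (79229371440084233697695367168,
   79229371458530977775699951617), (22025765260343416967959312072704,
   22104994636930142799420286501143), (370793458339594213705214318346240,
   392898453062855118789696060068703), (83666216240728950784766307729408,
   105771210897138855330559435408695), (2119544144765133419880746462478336,
   2596108814581684548776360314634239), (2596188043348680169806081791361024,
   5192296858534827628530496329220095), (5192296858534827628530496329220096,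
   5192376087906286159508272029171713), (1443458526672682080731477979523186688,
   1448672928525853838502807896138907927), (24299949297942993301522722820750049280,
   25748993019927273065001520992662524767), (5483065482612777975728204123656421376,
   6931822077354892022943543158944236855), (138904325559523708718447837799296008192,
   170138587272425278588607549579869519871), (170141183460469231731687303715884105728,
   340282366920938463463374607431768211455)]

theorem card_perm43 : Fintype.card (FM 7 perm43) = 294 := by
  have h : Evaluates (sumLeaves (fun _ => 1) steps43 0) 294 := by decide +kernel
  exact (card_eq_sumLeaves (l := orbits43) (by decide +kernel) (by decide +kernel)
    (by decide +kernel)).trans h.eq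

def perm331 : Equiv.Perm (Fin 7) :=
  ⟨![1, 2, 0, 4, 5, 3, 6], ![2, 0, 1, 5, 3, 4, 6], by decide, by decide⟩

def orbits331 : List (List ℕ) :=
  [[0], [1, 4, 2], [3, 5, 6], [7], [8, 32, 16], [9, 36, 18], [10, 33, 20], [11, 37, 22], [12, 34,
   17], [13, 38, 19], [14, 35, 21], [15, 39, 23], [24, 40, 48], [25, 44, 50], [26, 41, 52], [27,
   45, 54], [28, 42, 49], [29, 46, 51], [30, 43, 53], [31, 47, 55], [56], [57, 60, 58], [59, 61,
   62], [63], [64], [65, 68, 66], [67, 69, 70], [71], [72, 96, 80], [73, 100, 82], [74, 97, 84],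
   [75, 101, 86], [76, 98, 81], [77, 102, 83], [78, 99, 85], [79, 103, 87], [88, 104, 112], [89,
   108, 114], [90, 105, 116], [91, 109, 118], [92, 106, 113], [93, 110, 115], [94, 107, 117], [95,
   111, 119], [120], [121, 124, 122], [123, 125, 126], [127]]

def steps331 : List (ℕ × ℕ) :=
  [(1, 1), (22, 23), (104, 127), (128, 255), (4295033088, 4295033089), (68719739392, 73014772503),
   (8590984192, 12886017303), (137443149824, 219048906623), (17180004352, 21475037463),
   (274878439424, 365073216383), (34361851904, 64427873663), (549764235264, 1095233437695),
   (282574505115648, 282578800148737), (1143492126441472, 1426156826333975), (4505798717734912,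
   4788454828607255), (18049583015788544, 23981959472430975), (567348268367872, 849952839505175),
   (2322169094733824, 4315992020711295), (9015996421505024, 14371988503486335),
   (36169536654802944, 72057594037927935), (72057594037927936, 72340172838076673),
   (1585267068834414592, 1663823975275763479), (7493989779944505344, 9187201950435737471),
   (9223372036854775808, 18446744073709551615), (18446744073709551616, 18446744073709551617),
   (405828369621610135552, 424275113695319687191), (1918461383665793368064,
   2342736497361113055359), (2361183241434822606848, 4703919738795935662335),
   (79229376162450435092363870208, 79229376180897179170368454913),
   (1267655445376240825752692457472, 1346884821962966374613390787351),
   (158475686731108440732464054272, 237705063317833989533033628951),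
   (2535378609487846002217749315584, 4040739120100382201375431659391),
   (316915143466560305546848632832, 396144520053285854356007227671),
   (5070612223435201974848857309184, 6734412190783190038966948541311),
   (633864287971797272539235876864, 1188484496674652951336453363071),
   (10141360148793655691822575386624, 20203490926128780688443956002815),
   (5212579577623489120299512305287168, 5212658806999670017761257178857729),
   (21093706606767756883595278787018752, 26307949984356675532001035143287575),
   (83117315793704584682716110669217792, 88331400731836767882619350643181335),
   (332956038529425900250278626909487104, 442389068774008733105353040232136575),
   (10465728307244419080277881260081152, 15678862505074692595722413401117975),
   (42836458986432642218418793909059584, 79616000230233793402659331857414015),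
   (166315778556984326042451858931318784, 265116393754108357679896594136653695),
   (667210185935806607398337575076757504, 1329227995784915854529120580608720895),
   (1329227995784915872903807060280344576, 1334440654591915542993625911497130241),
   (29243015907268149203883755326167580672, 30692135055614057488853395964433995543),
   (138239711561631250781995934269155835904, 169473963133173273960190490760135540607),
   (170141183460469231731687303715884105728, 340282366920938463463374607431768211455)]

theorem card_perm331 : Fintype.card (FM 7 perm331) = 69264 := by
  have h : Evaluates (sumLeaves (fun _ => 1) steps331 0) 69264 := by decide +kernel
  exact (card_eq_sumLeaves (l := orbits331) (by decide +kernel) (by decide +kernel)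
    (by decide +kernel)).trans h.eq

/-- One permutation from each conjugacy class of `Equiv.Perm (Fin 7)`, with the size of its class
and the number of monotone Boolean functions it fixes. -/
def classes : List (Equiv.Perm (Fin 7) × ℕ × ℕ) :=
  [(fixThree (1 : Equiv.Perm (Fin 4)), 1, 2414682040998),
   (fixThree perm211, 21, 2208001624),
   (fixThree perm22, 105, 67922470),
   (perm2221, 105, 12015832),
   (fixThree perm31, 70, 2068224),
   (perm2311, 420, 59542),
   (perm331, 280, 69264),
   (perm232, 210, 10192),
   (fixThree perm4, 210, 60312),
   (perm241, 630, 26878),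
   (perm43, 420, 294),
   (perm511, 504, 1548),
   (perm25, 504, 264),
   (perm61, 840, 766),
   (perm7, 720, 101)]

def cycleTypes : List (Multiset ℕ) :=
  [∅, {2}, {2, 2}, {2, 2, 2}, {3}, {2, 3}, {3, 3}, {2, 2, 3}, {4}, {2, 4}, {4, 3}, {5}, {2, 5}, {6},
   {7}]

theorem map_cycleType_classes : classes.map (fun p => p.1.cycleType) = cycleTypes := by
  decide +kernel

theorem card_cycleTypes :
    cycleTypes.map (fun m => #{σ : Equiv.Perm (Fin 7) | σ.cycleType = m}) =
      classes.map (·.2.1) := by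
  simp only [Equiv.Perm.card_of_cycleType]
  decide +kernel

theorem card_class {p : Equiv.Perm (Fin 7) × ℕ × ℕ} (hp : p ∈ classes) :
    #{σ : Equiv.Perm (Fin 7) | σ.cycleType = p.1.cycleType} = p.2.1 := by
  have h := card_cycleTypes
  rw [← map_cycleType_classes, List.map_map] at h
  exact List.map_inj_left.1 h p hp

theorem card_fixed {p : Equiv.Perm (Fin 7) × ℕ × ℕ} (hp : p ∈ classes) :
    Fintype.card (FM 7 p.1) = p.2.2 := by
  revert p
  simp only [classes, List.forall_mem_cons, List.not_mem_nil, false_imp_iff, implies_true, and_true]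
  exact ⟨card_fixThree_one, card_fixThree_perm211, card_fixThree_perm22, card_perm2221,
    card_fixThree_perm31, card_perm2311, card_perm331, card_perm232, card_fixThree_perm4,
    card_perm241, card_perm43, card_perm511, card_perm25, card_perm61, card_perm7⟩

end MonotoneBool


/-- The number of equivalence classes of monotone Boolean functions of 7 variables
under the action of permutations of the input variables equals 490013148. -/
theorem r7_eq :
    Nat.card (Quotient (mbfSetoid 7)) = 490013148 := by
  have h := MonotoneBool.card_quotient_of_classes MonotoneBool.classes
    (by rw [MonotoneBool.map_cycleType_classes]; decide +kernel)
    (fun _ hp => MonotoneBool.card_class hp) (by decide +kernel)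
    (fun _ hp => MonotoneBool.card_fixed hp)
  refine Nat.eq_of_mul_eq_mul_right (Nat.factorial_pos 7) (h.trans ?_)
  decide +kernel
end

section
/- The number of monotone Boolean functions of 4 variables that are fixed points of the permutation of Fin 4 given by the product of transpositions (0 1)(2 3) equals 28. -/
/-- The permutation `(0 1)(2 3)` of the four coordinates. -/
abbrev doubleSwap : Equiv.Perm (Fin 4) := Equiv.swap 0 1 * Equiv.swap 2 3

/-- A representative of each of the ten orbits of `doubleSwap` on `Fin 4 → Bool`. -/
def orbitRep : Fin 10 → Fin 4 → Bool :=
  ![![false, false, false, false], ![true, false, false, false], ![false, false, true, false],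
    ![true, true, false, false], ![false, false, true, true], ![true, false, true, false],
    ![true, false, false, true], ![true, true, true, false], ![true, false, true, true],
    ![true, true, true, true]]

/-- The index of the orbit of a point. -/
def orbitIndex (x : Fin 4 → Bool) : Fin 10 :=
  ((List.finRange 10).find? fun i => orbitRep i = x ∨ orbitRep i = x ∘ doubleSwap).getD 0

/-- The order induced on the orbits. -/
abbrev OrbitLE (i j : Fin 10) : Prop :=
  (∀ k, orbitRep i k ≤ orbitRep j k) ∨ ∀ k, orbitRep i k ≤ orbitRep j (doubleSwap k)

theorem orbitIndex_orbitRep : ∀ i, orbitIndex (orbitRep i) = i := by decide +kernel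

theorem orbitIndex_comp_doubleSwap : ∀ x, orbitIndex (x ∘ doubleSwap) = orbitIndex x := by
  decide +kernel

theorem orbitRep_orbitIndex :
    ∀ x, orbitRep (orbitIndex x) = x ∨ orbitRep (orbitIndex x) = x ∘ doubleSwap := by
  decide +kernel

theorem orbitLE_orbitIndex_of_le :
    ∀ x y : Fin 4 → Bool, (∀ k, x k ≤ y k) → OrbitLE (orbitIndex x) (orbitIndex y) := by
  decide +kernel

/-- Invariant monotone functions are the monotone functions on the orbits. -/
def fixedEquivOrbitMonotone :
    {f : (Fin 4 → Bool) → Bool // Monotone f ∧ ∀ x, f (x ∘ doubleSwap) = f x} ≃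
      {g : Fin 10 → Bool // ∀ i j, OrbitLE i j → g i ≤ g j} where
  toFun f := ⟨fun i => f.1 (orbitRep i), fun i j h => by
    rcases h with h | h
    · exact f.2.1 h
    · exact (f.2.1 h).trans_eq (f.2.2 _)⟩
  invFun g := ⟨fun x => g.1 (orbitIndex x),
    fun x y h => g.2 _ _ (orbitLE_orbitIndex_of_le x y h),
    fun x => congrArg g.1 (orbitIndex_comp_doubleSwap x)⟩
  left_inv f := by
    ext x
    rcases orbitRep_orbitIndex x with h | h <;> simp only [h, f.2.2]
  right_inv g := by
    ext i
    simp only [orbitIndex_orbitRep]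

theorem card_orbit_monotone :
    Fintype.card {g : Fin 10 → Bool // ∀ i j, OrbitLE i j → g i ≤ g j} = 28 := by
  decide +kernel


/-- The number of monotone Boolean functions of 4 variables fixed by the
permutation (0 1)(2 3) equals 28. -/
theorem card_fixed_mbf :
    Nat.card {f : (Fin 4 → Bool) → Bool //
      Monotone f ∧ ∀ x : Fin 4 → Bool, f (x ∘ (Equiv.swap 0 1 * Equiv.swap 2 3 : Equiv.Perm (Fin 4))) = f x} = 28 := by
  rw [Nat.card_congr fixedEquivOrbitMonotone, Nat.card_eq_fintype_card, card_orbit_monotone]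
end
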